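/- arXiv:2312.10668 — 3 statements merged into one kernel-verified Lean document; each statement's English description precedes it below -/
import Mathlib

section
/- Let b ≥ 2 be an integer. Let N be a positive integer, ν the integer with b^{ν-2} ≤ N < b^{ν-1}, and M = b^{ν+τ} for an integer τ ≥ 1. Then there exists a constant c > 0 depending only on b and d such that for every finite sequence P_N = {p_n}_{n=1}^N in [0,1)^d, the quantity (M^{-d} Σ_{j₁,...,j_d=1}^M |D(A(j₁/M, ..., j_d/M), P_N)|²)^{1/2} is at least c·(log N)^{(d-1)/2}, where D(A(x), P_N) = Σ_{n=1}^N χ_{[0,x₁)×⋯×[0,x_d)}(p_n) - N·x₁⋯x_d. -/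
open Finset

namespace GridDiscrepancy

/-- The Haar function of scale `s` in base `b`: it takes the values `-1`, `1`, `0` according to
whether the base-`b` digit of `⌊k / s⌋` is `0`, `1` or larger. -/
noncomputable def haar (b s k : ℕ) : ℝ :=
  if k / s % b = 0 then -1 else if k / s % b = 1 then 1 else 0

lemma haar_sq_le_one (b s k : ℕ) : haar b s k ^ 2 ≤ 1 := by
  unfold haar; split_ifs <;> norm_num

lemma sum_range_mul_eq (g : ℕ → ℝ) (s b : ℕ) :
    ∑ k ∈ range (s * b), g k = ∑ c ∈ range b, ∑ m ∈ range s, g (s * c + m) := by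
  induction b with
  | zero => simp
  | succ b ih => rw [Nat.mul_succ, sum_range_add, ih, sum_range_succ]

lemma haar_block {b s : ℕ} (a : ℕ) {c m : ℕ} (hc : c < b) (hm : m < s) :
    haar b s (a * (s * b) + (s * c + m)) = if c = 0 then -1 else if c = 1 then 1 else 0 := by
  have hs : 0 < s := by omega
  have h : (a * (s * b) + (s * c + m)) / s % b = c := by
    have : a * (s * b) + (s * c + m) = m + s * (c + b * a) := by ring
    rw [this, Nat.add_mul_div_left _ _ hs, Nat.div_eq_of_lt hm, zero_add,
      Nat.add_mul_mod_self_left, Nat.mod_eq_of_lt hc]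
  simp only [haar, h]

lemma sum_haar_mul {b s : ℕ} (hb : 2 ≤ b) (a : ℕ) (g : ℕ → ℝ) :
    ∑ k ∈ Ico (a * (s * b)) ((a + 1) * (s * b)), haar b s k * g k =
      ∑ m ∈ range s, (g (a * (s * b) + (s + m)) - g (a * (s * b) + m)) := by
  have hsub : (a + 1) * (s * b) - a * (s * b) = s * b := by
    rw [add_mul, one_mul, Nat.add_sub_cancel_left]
  rw [sum_Ico_eq_sum_range, hsub, sum_range_mul_eq]
  have key : ∀ c ∈ range b, ∑ m ∈ range s,
      haar b s (a * (s * b) + (s * c + m)) * g (a * (s * b) + (s * c + m)) =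
      ∑ m ∈ range s, (if c = 0 then -1 else if c = 1 then 1 else 0) *
        g (a * (s * b) + (s * c + m)) := fun c hc => sum_congr rfl fun m hm => by
    rw [haar_block a (mem_range.1 hc) (mem_range.1 hm)]
  rw [sum_congr rfl key]
  obtain ⟨b', rfl⟩ := Nat.exists_eq_add_of_le' hb
  rw [sum_range_succ', sum_range_succ']
  simp [sub_eq_add_neg, sum_add_distrib]

lemma sum_haar {b s : ℕ} (hb : 2 ≤ b) (a : ℕ) :
    ∑ k ∈ Ico (a * (s * b)) ((a + 1) * (s * b)), haar b s k = 0 := by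
  simpa using sum_haar_mul (s := s) hb a fun _ => 1

lemma sum_haar_mul_succ {b s : ℕ} (hb : 2 ≤ b) (a : ℕ) :
    ∑ k ∈ Ico (a * (s * b)) ((a + 1) * (s * b)), haar b s k * ((k : ℝ) + 1) = (s : ℝ) ^ 2 := by
  rw [sum_haar_mul hb a fun k => (k : ℝ) + 1]
  have : ∀ m ∈ range s, (((a * (s * b) + (s + m) : ℕ) : ℝ) + 1 -
      (((a * (s * b) + m : ℕ) : ℝ) + 1)) = s := fun m _ => by push_cast; ring
  rw [sum_congr rfl this]
  simp [sq]

lemma sum_haar_mul_indicator {b s : ℕ} (hb : 2 ≤ b) (hs : 0 < s) {a q : ℕ}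
    (hq : q / (s * b) ≠ a) :
    ∑ k ∈ Ico (a * (s * b)) ((a + 1) * (s * b)), haar b s k * (if q ≤ k then 1 else 0) = 0 := by
  have hpos : 0 < s * b := by positivity
  have hsb : s * 2 ≤ s * b := Nat.mul_le_mul_left _ hb
  rw [sum_haar_mul hb a fun k => if q ≤ k then (1 : ℝ) else 0]
  refine sum_eq_zero fun m hm => ?_
  have hm := mem_range.1 hm
  rcases lt_or_gt_of_ne hq with h | h
  · have := (Nat.div_lt_iff_lt_mul hpos).1 h
    rw [if_pos (by omega), if_pos (by omega), sub_self]
  · have : (a + 1) * (s * b) ≤ q := (Nat.le_div_iff_mul_le hpos).1 h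
    rw [add_mul, one_mul] at this
    rw [if_neg (by omega), if_neg (by omega), sub_self]

variable {d : ℕ}

/-- The grid `[0, M)^d` is partitioned into the boxes with side lengths `tᵢ`. -/
lemma sum_piFinset_range_eq {t A : Fin d → ℕ} {M : ℕ} (ht : ∀ i, 0 < t i)
    (hM : ∀ i, A i * t i = M) (g : (Fin d → ℕ) → ℝ) :
    ∑ k ∈ Fintype.piFinset fun _ : Fin d => range M, g k =
      ∑ a ∈ Fintype.piFinset fun i => range (A i),
        ∑ k ∈ Fintype.piFinset fun i => Ico (a i * t i) ((a i + 1) * t i), g k := by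
  have maps : ∀ k ∈ Fintype.piFinset fun _ : Fin d => range M,
      (fun i => k i / t i) ∈ Fintype.piFinset fun i => range (A i) := by
    intro k hk
    simp only [Fintype.mem_piFinset, mem_range] at hk ⊢
    intro i
    rw [Nat.div_lt_iff_lt_mul (ht i), hM]
    exact hk i
  rw [← sum_fiberwise_of_maps_to maps]
  refine sum_congr rfl fun a ha => sum_congr ?_ fun _ _ => rfl
  ext k
  simp only [mem_filter, Fintype.mem_piFinset, mem_range, mem_Ico, funext_iff] at ha ⊢
  constructor
  · rintro ⟨-, h⟩ i
    rw [← h i]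
    exact ⟨Nat.div_mul_le_self _ _, by
      rw [mul_comm]; exact Nat.lt_mul_div_succ _ (ht i)⟩
  · intro h
    refine ⟨fun i => (h i).2.trans_le ?_, fun i => ?_⟩
    · rw [← hM i]; exact Nat.mul_le_mul_right _ (ha i)
    · exact Nat.div_eq_of_lt_le (h i).1 (h i).2

lemma sum_haar_mul_eq_zero {b s B M : ℕ} (hb : 2 ≤ b) (hs : 0 < s) (hM : B * (s * b) = M)
    (i : Fin d) (G : (Fin d → ℕ) → ℝ)
    (hG : ∀ k k' : Fin d → ℕ, (∀ j, j ≠ i → k j = k' j) → k i / (s * b) = k' i / (s * b) →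
      G k = G k') :
    ∑ k ∈ Fintype.piFinset fun _ : Fin d => range M, haar b s (k i) * G k = 0 := by
  have hpos : 0 < s * b := by positivity
  rw [sum_piFinset_range_eq (t := fun j => if j = i then s * b else 1)
    (A := fun j => if j = i then B else M) (fun j => by split_ifs <;> omega)
    (fun j => by split_ifs <;> simp [hM])]
  refine sum_eq_zero fun a _ => ?_
  set t : Fin d → ℕ := fun j => if j = i then s * b else 1 with ht
  have hti : t i = s * b := by simp [ht]
  have htj : ∀ j, j ≠ i → t j = 1 := fun j hj => by simp [ht, hj]
  have hconst : ∀ k ∈ Fintype.piFinset fun j => Ico (a j * t j) ((a j + 1) * t j),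
      haar b s (k i) * G k =
        (∏ j, if j = i then haar b s (k j) else 1) * G fun j => a j * t j := by
    intro k hk
    simp only [Fintype.mem_piFinset, mem_Ico] at hk
    rw [prod_ite_eq' univ i fun j => haar b s (k j), if_pos (mem_univ _)]
    congr 1
    refine hG _ _ (fun j hj => ?_) ?_
    · have := hk j
      rw [htj j hj] at this ⊢
      omega
    · have := hk i
      rw [hti] at this ⊢
      rw [Nat.div_eq_of_lt_le this.1 this.2, Nat.mul_div_cancel _ hpos]
  rw [sum_congr rfl hconst, ← sum_mul,
    ← prod_univ_sum (fun j => Ico (a j * t j) ((a j + 1) * t j))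
      fun j x => if j = i then haar b s x else 1, prod_eq_zero (mem_univ i), zero_mul]
  simpa [hti] using sum_haar hb (a i)

variable {N : ℕ}

/-- The product Haar function with scales `sᵢ`, restricted to the boxes of side lengths `sᵢ b`
that contain none of the points `q n`. -/
noncomputable def rothFun (b : ℕ) (q : Fin N → Fin d → ℕ) (s k : Fin d → ℕ) : ℝ :=
  (if ∃ n, ∀ i, q n i / (s i * b) = k i / (s i * b) then 0 else 1) * ∏ i, haar b (s i) (k i)

lemma rothFun_sq_le_one (b : ℕ) (q : Fin N → Fin d → ℕ) (s k : Fin d → ℕ) :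
    rothFun b q s k ^ 2 ≤ 1 := by
  unfold rothFun
  rw [mul_pow, ← prod_pow]
  refine mul_le_one₀ ?_ (prod_nonneg fun i _ => sq_nonneg _)
    (prod_le_one (fun i _ => sq_nonneg _) fun i _ => haar_sq_le_one _ _ _)
  split_ifs <;> norm_num

lemma sum_rothFun_mul_rothFun {b M B : ℕ} (hb : 2 ≤ b) (q : Fin N → Fin d → ℕ)
    {s s' : Fin d → ℕ} {i : Fin d} (hs : 0 < s i) (hM : B * (s i * b) = M)
    (hdvd : s i * b ∣ s' i) :
    ∑ k ∈ Fintype.piFinset fun _ : Fin d => range M, rothFun b q s k * rothFun b q s' k = 0 := by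
  have hfactor : ∀ k : Fin d → ℕ, rothFun b q s k * rothFun b q s' k = haar b (s i) (k i) *
      ((if ∃ n, ∀ i, q n i / (s i * b) = k i / (s i * b) then 0 else 1) *
        (∏ j ∈ univ.erase i, haar b (s j) (k j)) * rothFun b q s' k) := by
    intro k
    rw [rothFun, ← mul_prod_erase univ (fun j => haar b (s j) (k j)) (mem_univ i)]
    ring
  simp_rw [hfactor]
  refine sum_haar_mul_eq_zero hb hs hM i _ fun k k' hne hi => ?_
  have hdiv : ∀ j, k j / (s j * b) = k' j / (s j * b) := fun j => by
    by_cases hj : j = i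
    · rw [hj, hi]
    · rw [hne j hj]
  have hdiv' : ∀ j, k j / s' j = k' j / s' j := fun j => by
    by_cases hj : j = i
    · obtain ⟨c, hc⟩ := hdvd
      rw [hj, hc, ← Nat.div_div_eq_div_mul _ (s i * b), hi, Nat.div_div_eq_div_mul]
    · rw [hne j hj]
  have hprod : ∏ j ∈ univ.erase i, haar b (s j) (k j) = ∏ j ∈ univ.erase i, haar b (s j) (k' j) :=
    prod_congr rfl fun j hj => by rw [hne j (ne_of_mem_erase hj)]
  have hroth : rothFun b q s' k = rothFun b q s' k' := by
    simp only [rothFun, haar, ← Nat.div_div_eq_div_mul, hdiv']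
  rw [hprod, hroth]
  simp only [hdiv]

/-- The discrepancy of the points `(q n + 1) / M` in the closed anchored box with upper vertex
`(k + 1) / M`. -/
noncomputable def gridDisc (M : ℕ) (q : Fin N → Fin d → ℕ) (k : Fin d → ℕ) : ℝ :=
  (∑ n, ∏ i, if q n i ≤ k i then (1 : ℝ) else 0) - N * ∏ i, ((k i : ℝ) + 1) / M

lemma sum_box_rothFun_mul_gridDisc {b M : ℕ} (hb : 2 ≤ b) (q : Fin N → Fin d → ℕ)
    {s : Fin d → ℕ} (hs : ∀ i, 0 < s i) (a : Fin d → ℕ) :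
    ∑ k ∈ Fintype.piFinset fun i => Ico (a i * (s i * b)) ((a i + 1) * (s i * b)),
        rothFun b q s k * gridDisc M q k =
      -(if ∃ n, ∀ i, q n i / (s i * b) = a i then 0 else N * ∏ i, (s i : ℝ) ^ 2 / M) := by
  have hdiv : ∀ k ∈ Fintype.piFinset fun i => Ico (a i * (s i * b)) ((a i + 1) * (s i * b)),
      ∀ i, k i / (s i * b) = a i := by
    intro k hk i
    simp only [Fintype.mem_piFinset, mem_Ico] at hk
    exact Nat.div_eq_of_lt_le (hk i).1 (hk i).2
  split_ifs with h
  · rw [neg_zero]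
    refine sum_eq_zero fun k hk => ?_
    simp only [rothFun, hdiv k hk, if_pos h, zero_mul]
  · have hexp : ∀ k ∈ Fintype.piFinset fun i => Ico (a i * (s i * b)) ((a i + 1) * (s i * b)),
        rothFun b q s k * gridDisc M q k =
          (∑ n, ∏ i, haar b (s i) (k i) * if q n i ≤ k i then (1 : ℝ) else 0) -
            N * ∏ i, haar b (s i) (k i) * (((k i : ℝ) + 1) / M) := by
      intro k hk
      simp only [rothFun, hdiv k hk, if_neg h, one_mul, gridDisc, prod_mul_distrib, mul_sub,
        mul_sum]
      ring
    rw [sum_congr rfl hexp, sum_sub_distrib, sum_comm, ← mul_sum,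
      ← prod_univ_sum (fun i => Ico (a i * (s i * b)) ((a i + 1) * (s i * b)))
        fun i x => haar b (s i) x * (((x : ℝ) + 1) / M)]
    have hzero : ∀ n ∈ (univ : Finset (Fin N)),
        ∑ k ∈ Fintype.piFinset fun i => Ico (a i * (s i * b)) ((a i + 1) * (s i * b)),
          ∏ i, (haar b (s i) (k i) * if q n i ≤ k i then (1 : ℝ) else 0) = 0 := by
      intro n _
      push Not at h
      obtain ⟨i, hi⟩ := h n
      rw [← prod_univ_sum (fun i => Ico (a i * (s i * b)) ((a i + 1) * (s i * b)))
        fun i x => haar b (s i) x * if q n i ≤ x then (1 : ℝ) else 0]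
      exact prod_eq_zero (mem_univ i) (sum_haar_mul_indicator hb (hs i) hi)
    rw [sum_eq_zero hzero, zero_sub]
    simp_rw [← mul_div_assoc, ← sum_div, sum_haar_mul_succ hb]

lemma sum_rothFun_mul_gridDisc_le {b M : ℕ} (hb : 2 ≤ b) (q : Fin N → Fin d → ℕ)
    {s A : Fin d → ℕ} (hs : ∀ i, 0 < s i) (hM : ∀ i, A i * (s i * b) = M) :
    ∑ k ∈ Fintype.piFinset fun _ : Fin d => range M, rothFun b q s k * gridDisc M q k ≤
      -((∏ i, (A i : ℝ)) - N) * (N * ∏ i, (s i : ℝ) ^ 2 / M) := by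
  rw [sum_piFinset_range_eq (fun i => Nat.mul_pos (hs i) (by omega)) hM]
  simp_rw [sum_box_rothFun_mul_gridDisc hb q hs]
  set V : ℝ := N * ∏ i, (s i : ℝ) ^ 2 / M with hV
  have hV0 : 0 ≤ V := by positivity
  set X := Fintype.piFinset fun i => range (A i) with hX
  set E := univ.image fun n i => q n i / (s i * b) with hE
  have hiff : ∀ a : Fin d → ℕ, (∃ n, ∀ i, q n i / (s i * b) = a i) ↔ a ∈ E := by
    intro a; simp [hE, funext_iff]
  have hcardE : #E ≤ N := card_image_le.trans_eq (by simp)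
  have hcardX : #X = ∏ i, A i := by simp [hX, Fintype.card_piFinset]
  have hcard : (∏ i, (A i : ℝ)) - N ≤ #(X \ E) := by
    have h1 : #X - #E ≤ #(X \ E) := le_card_sdiff _ _
    have h2 : #X ≤ #(X \ E) + N := by omega
    have h3 : ((#X : ℕ) : ℝ) ≤ #(X \ E) + N := by exact_mod_cast h2
    rw [hcardX] at h3
    push_cast at h3
    linarith
  have hsum : ∑ a ∈ X, -(if ∃ n, ∀ i, q n i / (s i * b) = a i then 0 else V) =
      -(#(X \ E) * V) := by
    rw [sum_neg_distrib, neg_inj, sdiff_eq_filter]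
    simp only [hiff, card_filter, Nat.cast_sum, sum_mul]
    exact sum_congr rfl fun a _ => by by_cases h : a ∈ E <;> simp [h]
  rw [hsum]
  nlinarith [mul_le_mul_of_nonneg_right hcard hV0]

/-- Roth's lower bound on the grid for a family of scales with orthogonal Roth functions. -/
lemma sum_sq_gridDisc_ge {ι : Type*} {b M : ℕ} (q : Fin N → Fin d → ℕ) (R : Finset ι)
    (s : ι → Fin d → ℕ) {c : ℝ} (hc : 0 ≤ c)
    (horth : ∀ r ∈ R, ∀ r' ∈ R, r ≠ r' → ∑ k ∈ Fintype.piFinset fun _ : Fin d => range M,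
      rothFun b q (s r) k * rothFun b q (s r') k = 0)
    (hcorr : ∀ r ∈ R, ∑ k ∈ Fintype.piFinset fun _ : Fin d => range M,
      rothFun b q (s r) k * gridDisc M q k ≤ -(c * M ^ d)) (hM : 0 < M) :
    c ^ 2 * #R ≤ 1 / (M : ℝ) ^ d *
      ∑ k ∈ Fintype.piFinset fun _ : Fin d => range M, gridDisc M q k ^ 2 := by
  classical
  set S := Fintype.piFinset fun _ : Fin d => range M with hS
  have hMd : (0 : ℝ) < (M : ℝ) ^ d := by positivity
  have hnorm : ∑ k ∈ S, (∑ r ∈ R, rothFun b q (s r) k) ^ 2 ≤ #R * (M : ℝ) ^ d := by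
    calc ∑ k ∈ S, (∑ r ∈ R, rothFun b q (s r) k) ^ 2
        = ∑ r ∈ R, ∑ r' ∈ R, ∑ k ∈ S, rothFun b q (s r) k * rothFun b q (s r') k := by
          simp_rw [sq, sum_mul_sum]
          rw [sum_comm]
          exact sum_congr rfl fun r _ => sum_comm
      _ = ∑ r ∈ R, ∑ k ∈ S, rothFun b q (s r) k ^ 2 := by
          refine sum_congr rfl fun r hr => ?_
          rw [sum_eq_single_of_mem r hr fun r' hr' hne => horth r hr r' hr' hne.symm]
          simp_rw [sq]
      _ ≤ ∑ r ∈ R, ∑ k ∈ S, (1 : ℝ) :=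
          sum_le_sum fun r _ => sum_le_sum fun k _ => rothFun_sq_le_one _ _ _ _
      _ = #R * (M : ℝ) ^ d := by simp [hS, Fintype.card_piFinset]
  have hinner : ∑ k ∈ S, (∑ r ∈ R, rothFun b q (s r) k) * gridDisc M q k ≤
      -(#R * (c * (M : ℝ) ^ d)) := by
    simp_rw [sum_mul]
    rw [sum_comm]
    calc _ ≤ ∑ r ∈ R, -(c * (M : ℝ) ^ d) := sum_le_sum hcorr
      _ = _ := by simp
  have hcs := sum_mul_sq_le_sq_mul_sq S (fun k => ∑ r ∈ R, rothFun b q (s r) k) (gridDisc M q)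
  set D := ∑ k ∈ S, gridDisc M q k ^ 2 with hD
  have hD0 : 0 ≤ D := sum_nonneg fun _ _ => sq_nonneg _
  rcases R.eq_empty_or_nonempty with rfl | hR
  · simp only [card_empty, Nat.cast_zero, mul_zero]; positivity
  have hRpos : (0 : ℝ) < #R := by exact_mod_cast hR.card_pos
  have hlow : (#R * (c * (M : ℝ) ^ d)) ^ 2 ≤ #R * (M : ℝ) ^ d * D :=
    calc (#R * (c * (M : ℝ) ^ d)) ^ 2
        ≤ (∑ k ∈ S, (∑ r ∈ R, rothFun b q (s r) k) * gridDisc M q k) ^ 2 := by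
          have : 0 ≤ #R * (c * (M : ℝ) ^ d) := by positivity
          nlinarith
      _ ≤ _ := hcs
      _ ≤ _ := mul_le_mul_of_nonneg_right hnorm hD0
  rw [one_div, inv_mul_eq_div, le_div_iff₀ hMd]
  have : (#R * (M : ℝ) ^ d) * (c ^ 2 * #R * (M : ℝ) ^ d) ≤ (#R * (M : ℝ) ^ d) * D := by
    linarith [hlow, show (#R * (c * (M : ℝ) ^ d)) ^ 2 =
      (#R * (M : ℝ) ^ d) * (c ^ 2 * #R * (M : ℝ) ^ d) by ring]
  exact le_of_mul_le_mul_left this (by positivity)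

lemma sum_sq_gridDisc_ge_card {b ν τ : ℕ} (hb : 2 ≤ b) (hν : 2 ≤ ν) (hτ : 1 ≤ τ)
    (hN : b ^ (ν - 2) ≤ N) (hN' : N < b ^ (ν - 1)) (q : Fin N → Fin d → ℕ)
    (R : Finset (Fin d → ℕ)) (hR : ∀ r ∈ R, ∑ i, r i = ν) :
    (1 / (2 * (b : ℝ) ^ (2 + 2 * d))) ^ 2 * #R ≤ 1 / ((b ^ (ν + τ) : ℕ) : ℝ) ^ d *
      ∑ k ∈ Fintype.piFinset fun _ : Fin d => range (b ^ (ν + τ)),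
        gridDisc (b ^ (ν + τ)) q k ^ 2 := by
  have hb0 : 0 < b := by omega
  have hle : ∀ r ∈ R, ∀ i, r i ≤ ν := fun r hr i => by
    rw [← hR r hr]; exact single_le_sum (fun _ _ => Nat.zero_le _) (mem_univ i)
  have hM : ∀ r ∈ R, ∀ i, b ^ r i * (b ^ (ν + τ - r i - 1) * b) = b ^ (ν + τ) := by
    intro r hr i
    have := hle r hr i
    rw [← pow_succ, ← pow_add]
    congr 1; omega
  refine sum_sq_gridDisc_ge (b := b) q R (fun r i => b ^ (ν + τ - r i - 1)) (by positivity)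
    ?_ ?_ (by positivity)
  · have horth : ∀ r ∈ R, ∀ r' ∈ R, ∀ i, r' i < r i →
        ∑ k ∈ Fintype.piFinset fun _ : Fin d => range (b ^ (ν + τ)),
          rothFun b q (fun i => b ^ (ν + τ - r i - 1)) k *
            rothFun b q (fun i => b ^ (ν + τ - r' i - 1)) k = 0 := by
      intro r hr r' hr' i hi
      have := hle r hr i
      refine sum_rothFun_mul_rothFun hb q (i := i) (by positivity) (hM r hr i) ?_
      rw [← pow_succ]
      exact pow_dvd_pow _ (by omega)
    intro r hr r' hr' hne
    obtain ⟨i, hi⟩ := Function.ne_iff.1 hne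
    rcases lt_or_gt_of_ne hi with h | h
    · simp_rw [mul_comm (rothFun b q (fun i => b ^ (ν + τ - r i - 1)) _)]
      exact horth r' hr' r hr i h
    · exact horth r hr r' hr' i h
  · intro r hr
    refine (sum_rothFun_mul_gridDisc_le hb q (fun i => by positivity) (hM r hr)).trans ?_
    have hbR : (2 : ℝ) ≤ b := by exact_mod_cast hb
    have hprodA : ∏ i, ((b ^ r i : ℕ) : ℝ) = (b : ℝ) ^ ν := by
      push_cast
      rw [prod_pow_eq_pow_sum, hR r hr]
    have hbox : ∀ i, ((b ^ (ν + τ - r i - 1) : ℕ) : ℝ) ^ 2 / ((b ^ (ν + τ) : ℕ) : ℝ) =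
        ((b ^ (ν + τ) : ℕ) : ℝ) / ((b : ℝ) ^ 2 * ((b : ℝ) ^ r i) ^ 2) := by
      intro i
      have h : (b : ℝ) ^ r i * ((b : ℝ) ^ (ν + τ - r i - 1) * b) = (b : ℝ) ^ (ν + τ) := by
        exact_mod_cast hM r hr i
      push_cast
      rw [div_eq_div_iff (by positivity) (by positivity), ← h]
      ring
    have hprod : ∏ i, ((b ^ (ν + τ - r i - 1) : ℕ) : ℝ) ^ 2 / ((b ^ (ν + τ) : ℕ) : ℝ) =
        ((b ^ (ν + τ) : ℕ) : ℝ) ^ d / ((b : ℝ) ^ (2 * d) * ((b : ℝ) ^ ν) ^ 2) := by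
      simp_rw [hbox]
      rw [prod_div_distrib, prod_mul_distrib, prod_pow _ 2 fun i => (b : ℝ) ^ r i,
        prod_pow_eq_pow_sum _ r, hR r hr]
      simp [pow_mul]
    rw [hprodA, hprod]
    have hNlow : (b : ℝ) ^ ν ≤ N * (b : ℝ) ^ 2 := by
      have : (b : ℝ) ^ ν = (b : ℝ) ^ (ν - 2) * (b : ℝ) ^ 2 := by
        rw [← pow_add]; congr 1; omega
      rw [this]
      gcongr
      exact_mod_cast hN
    have hNup : 2 * (N : ℝ) ≤ (b : ℝ) ^ ν := by
      have h1 : (b : ℝ) ^ ν = (b : ℝ) * (b : ℝ) ^ (ν - 1) := by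
        rw [← pow_succ']; congr 1; omega
      rw [h1]
      have h2 : (N : ℝ) ≤ (b : ℝ) ^ (ν - 1) := by exact_mod_cast hN'.le
      gcongr
    have hpow : (0 : ℝ) < (b : ℝ) ^ ν := by positivity
    set K : ℝ := ((b ^ (ν + τ) : ℕ) : ℝ) ^ d / (b : ℝ) ^ (2 * d) with hK
    have hK0 : 0 ≤ K := by positivity
    have e1 : ((b ^ (ν + τ) : ℕ) : ℝ) ^ d / ((b : ℝ) ^ (2 * d) * ((b : ℝ) ^ ν) ^ 2) =
        K / ((b : ℝ) ^ ν) ^ 2 := by rw [hK, div_div]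
    have e2 : 1 / (2 * (b : ℝ) ^ (2 + 2 * d)) * ((b ^ (ν + τ) : ℕ) : ℝ) ^ d =
        K / (2 * (b : ℝ) ^ 2) := by
      rw [hK, pow_add]; field_simp
    rw [e1, e2, neg_mul, neg_le_neg_iff, ← mul_div_assoc, ← mul_div_assoc,
      div_le_div_iff₀ (by positivity) (by positivity)]
    have : ((b : ℝ) ^ ν) ^ 2 ≤ ((b : ℝ) ^ ν - N) * N * (2 * (b : ℝ) ^ 2) := by
      calc ((b : ℝ) ^ ν) ^ 2 = (b : ℝ) ^ ν * (b : ℝ) ^ ν := sq _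
        _ ≤ (2 * ((b : ℝ) ^ ν - N)) * (N * (b : ℝ) ^ 2) :=
          mul_le_mul (by linarith) hNlow hpow.le (by linarith)
        _ = _ := by ring
    nlinarith [mul_le_mul_of_nonneg_left this hK0]

lemma exists_finset_sum_eq (e ν : ℕ) :
    ∃ R : Finset (Fin (e + 1) → ℕ), (∀ r ∈ R, ∑ i, r i = ν) ∧
      ((ν : ℝ) / (e + 1)) ^ e ≤ #R := by
  classical
  set G := Fintype.piFinset fun _ : Fin e => range (ν / (e + 1) + 1) with hG
  refine ⟨G.image fun g => Fin.cons (ν - ∑ i, g i) g, ?_, ?_⟩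
  · intro r hr
    obtain ⟨g, hg, rfl⟩ := mem_image.1 hr
    simp only [hG, Fintype.mem_piFinset, mem_range, Nat.lt_succ_iff] at hg
    have h1 : ∑ i, g i ≤ e * (ν / (e + 1)) := by
      simpa using sum_le_card_nsmul univ g _ fun i _ => hg i
    have h2 : (e + 1) * (ν / (e + 1)) ≤ ν := Nat.mul_div_le _ _
    have h3 : ∑ i, g i ≤ ν := h1.trans (le_trans (Nat.mul_le_mul_right _ (by omega)) h2)
    rw [Fin.sum_univ_succ]
    simp only [Fin.cons_zero, Fin.cons_succ]
    omega
  · rw [card_image_of_injective _ fun g g' h => (Fin.cons_inj.1 h).2]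
    have hcard : #G = (ν / (e + 1) + 1) ^ e := by simp [hG, Fintype.card_piFinset]
    rw [hcard]
    push_cast
    gcongr
    have : ν < (e + 1) * (ν / (e + 1) + 1) := Nat.lt_mul_div_succ _ (by omega)
    rw [div_le_iff₀ (by positivity), mul_comm]
    exact_mod_cast this.le

lemma sum_sq_eq_sum_sq_gridDisc {M : ℕ} (hM : 0 < M) (p : Fin N → Fin d → ℝ)
    (hp : ∀ n i, p n i ∈ Set.Ico (0 : ℝ) 1) :
    ∑ j ∈ Fintype.piFinset fun _ : Fin d => Icc 1 M,
      |(∑ n, Set.indicator {y : Fin d → ℝ | ∀ i, y i ∈ Set.Ico (0 : ℝ) ((j i : ℝ) / M)}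
        (fun _ => (1 : ℝ)) (p n)) - N * ∏ i, (j i : ℝ) / M| ^ 2 =
    ∑ k ∈ Fintype.piFinset fun _ : Fin d => range M,
      gridDisc M (fun n i => ⌊p n i * M⌋₊) k ^ 2 := by
  symm
  refine sum_bij' (fun k _ i => k i + 1) (fun j _ i => j i - 1) ?_ ?_ ?_ ?_ ?_
  · intro k hk
    simp only [Fintype.mem_piFinset, mem_range, mem_Icc] at hk ⊢
    intro i; have := hk i; omega
  · intro k hk
    simp only [Fintype.mem_piFinset, mem_range, mem_Icc] at hk ⊢
    intro i; have := hk i; omega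
  · intro k _; simp
  · intro k hk
    simp only [Fintype.mem_piFinset, mem_Icc] at hk
    funext i; have := hk i; dsimp only; omega
  · intro k _
    have hMR : (0 : ℝ) < M := by exact_mod_cast hM
    rw [sq_abs, gridDisc]
    congr 2
    · refine sum_congr rfl fun n _ => ?_
      have hiff : ∀ i, p n i ∈ Set.Ico (0 : ℝ) (((k i + 1 : ℕ) : ℝ) / M) ↔
          ⌊p n i * M⌋₊ ≤ k i := by
        intro i
        have h0 := (hp n i).1
        rw [Set.mem_Ico, lt_div_iff₀ hMR, ← Nat.floor_lt (by positivity), Nat.lt_succ_iff]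
        exact and_iff_right h0
      rw [Set.indicator_apply]
      simp only [Set.mem_ofPred_eq, hiff]
      by_cases h : ∀ i, ⌊p n i * M⌋₊ ≤ k i
      · rw [if_pos h]; exact prod_eq_one fun i _ => if_pos (h i)
      · rw [if_neg h]
        push Not at h
        obtain ⟨i, hi⟩ := h
        exact prod_eq_zero (mem_univ i) (if_neg (not_le.2 hi))
    · push_cast; rfl

end GridDiscrepancy

open GridDiscrepancy in
/-- Discrete version of Roth's lower bound: the `ℓ²` average of the discrepancy with
respect to anchored boxes with upper-right vertex on the grid `(j₁/M,…,j_d/M)`,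
`1 ≤ jᵢ ≤ M`, `M = b^(ν+τ)`, is at least `c·(log N)^((d-1)/2)`. -/
theorem stmt3 (b d : ℕ) (hb : 2 ≤ b) (hd : 1 ≤ d) :
    ∃ c : ℝ, 0 < c ∧
      ∀ (N ν τ M : ℕ), 0 < N → b ^ (ν - 2) ≤ N → N < b ^ (ν - 1) → 1 ≤ τ →
        M = b ^ (ν + τ) →
        ∀ p : Fin N → Fin d → ℝ, (∀ n i, p n i ∈ Set.Ico (0 : ℝ) 1) →
          c * Real.log N ^ (((d : ℝ) - 1) / 2) ≤
            Real.sqrt ((1 / (M : ℝ) ^ d) *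
              ∑ j ∈ Fintype.piFinset fun _ : Fin d => Finset.Icc 1 M,
                |(∑ n, Set.indicator
                    {y : Fin d → ℝ | ∀ i, y i ∈ Set.Ico (0 : ℝ) ((j i : ℝ) / M)}
                    (fun _ => (1 : ℝ)) (p n)) - N * ∏ i, (j i : ℝ) / M| ^ 2) := by
  obtain ⟨e, rfl⟩ := Nat.exists_eq_add_of_le' hd
  have hb1 : (1 : ℝ) < b := by exact_mod_cast hb
  have hlogb : 0 < Real.log b := Real.log_pos hb1
  set c₀ : ℝ := 1 / (2 * (b : ℝ) ^ (2 + 2 * (e + 1))) with hc₀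
  have hc₀pos : 0 < c₀ := by positivity
  set Λ : ℝ := (e + 1) * Real.log b with hΛ
  have hΛpos : 0 < Λ := by positivity
  refine ⟨c₀ / Λ ^ ((e : ℝ) / 2), by positivity, ?_⟩
  intro N ν τ M hN hlow hup hτ hM p hp
  have hν : 2 ≤ ν := by
    by_contra! h
    rw [show ν - 1 = 0 by omega, pow_zero] at hup
    omega
  subst hM
  obtain ⟨R, hR, hcard⟩ := exists_finset_sum_eq e ν
  rw [sum_sq_eq_sum_sq_gridDisc (by positivity) p hp]
  refine le_trans ?_ (Real.sqrt_le_sqrt (sum_sq_gridDisc_ge_card hb hν hτ hlow hup _ R hR))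
  rw [← hc₀, Real.sqrt_mul (sq_nonneg _), Real.sqrt_sq hc₀pos.le]
  have hlogN : Real.log N ≤ ν * Real.log b := by
    rw [← Real.log_pow]
    refine Real.log_le_log (by exact_mod_cast hN) ?_
    exact_mod_cast hup.le.trans (Nat.pow_le_pow_right (by omega) (by omega))
  have hexp : (((e + 1 : ℕ) : ℝ) - 1) / 2 = (e : ℝ) / 2 := by push_cast; ring
  rw [hexp]
  calc c₀ / Λ ^ ((e : ℝ) / 2) * Real.log N ^ ((e : ℝ) / 2)
      ≤ c₀ / Λ ^ ((e : ℝ) / 2) * (ν * Real.log b) ^ ((e : ℝ) / 2) := by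
        have : 0 ≤ Real.log N := Real.log_natCast_nonneg N
        gcongr
    _ = c₀ * ((ν : ℝ) / (e + 1)) ^ ((e : ℝ) / 2) := by
        have hquot : (ν : ℝ) / (e + 1) = ν * Real.log b / Λ := by
          rw [hΛ]; field_simp
        rw [hquot, Real.div_rpow (by positivity) hΛpos.le]
        ring
    _ = c₀ * √(((ν : ℝ) / (e + 1)) ^ e) := by
        rw [Real.sqrt_eq_rpow, ← Real.rpow_natCast, ← Real.rpow_mul (by positivity)]
        ring_nf
    _ ≤ c₀ * √(#R : ℝ) := by gcongr
end

section
/- Let b ≥ 2 be an integer. Let N ≥ 2 be an integer, ν the integer with b^{ν-2} ≤ N < b^{ν-1}, and M = b^{ν+τ} for an integer τ ≥ 1. Then there exists a constant c̃ > 0 depending only on b such that for every finite sequence P_N of N points in [0,1)², there exist integers 1 ≤ j₁, j₂ ≤ M with |D(A(j₁/M, j₂/M), P_N)| ≥ c̃·log N. -/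
open Finset

/-- Maximum of `f` over the block `[s * L, (s + 1) * L)`. -/
noncomputable def blockMax (f : ℕ → ℝ) (L s : ℕ) : ℝ := ⨆ i : Fin L, f (s * L + i)

lemma le_blockMax (f : ℕ → ℝ) {L s i : ℕ} (hi : i < L) : f (s * L + i) ≤ blockMax f L s :=
  le_ciSup (f := fun i : Fin L => f (s * L + i)) (Set.finite_range _).bddAbove ⟨i, hi⟩

lemma blockMax_le {f : ℕ → ℝ} {L s : ℕ} (hL : 0 < L) {a : ℝ}
    (h : ∀ i < L, f (s * L + i) ≤ a) : blockMax f L s ≤ a := by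
  have : Nonempty (Fin L) := ⟨⟨0, hL⟩⟩
  exact ciSup_le fun i => h i i.2

lemma blockMax_sub_block_le (f : ℕ → ℝ) {B L s i : ℕ} (hL : 0 < L) (hi : i < B) :
    blockMax f L (B * s + i) ≤ blockMax f (B * L) s := by
  refine blockMax_le hL fun k hk => ?_
  have h : i * L + k < B * L := by nlinarith [Nat.mul_le_mul_right L (Nat.succ_le_of_lt hi)]
  have := le_blockMax f (s := s) h
  convert this using 2
  ring

/-- The maximum over a long block beats the average of the maxima over its sub-blocks. -/
lemma sum_blockMax_add_abs_le (f : ℕ → ℝ) {B L : ℕ} (s : ℕ) (hL : 0 < L) (hB : 3 ≤ B) :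
    ∑ i ∈ range B, blockMax f L (B * s + i)
        + |blockMax f L (B * s + 2) - blockMax f L (B * s + 0)|
      ≤ B * blockMax f (B * L) s := by
  set G := blockMax f (B * L) s
  have hle : ∀ i ∈ range B, 0 ≤ G - blockMax f L (B * s + i) := fun i hi =>
    sub_nonneg.2 (blockMax_sub_block_le f hL (mem_range.1 hi))
  have hsub : ({0, 2} : Finset ℕ) ⊆ range B := by
    intro i hi
    simp only [mem_insert, mem_singleton] at hi
    rw [mem_range]
    omega
  have h := sum_le_sum_of_subset_of_nonneg hsub fun i hi _ => hle i hi
  rw [sum_pair (by norm_num), sum_sub_distrib, sum_const, card_range, nsmul_eq_mul] at h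
  have h0 := hle 0 (hsub (by simp))
  have h2 := hle 2 (hsub (by simp))
  rcases abs_cases (blockMax f L (B * s + 2) - blockMax f L (B * s + 0)) with h' | h' <;> linarith

/-- If two functions differ by an affine function of slope `-δ` on a long block, then the
differences of maxima over two separated sub-blocks cannot both be small. -/
lemma mul_le_abs_add_abs_of_affine {f g : ℕ → ℝ} {B L s : ℕ} {C δ : ℝ} (hL : 0 < L) (hB : 3 ≤ B)
    (hδ : 0 ≤ δ) (hfg : ∀ j < B * L, g (s * (B * L) + j) = f (s * (B * L) + j) + C - δ * j) :
    δ * L ≤ |blockMax f L (B * s + 2) - blockMax f L (B * s + 0)|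
      + |blockMax g L (B * s + 2) - blockMax g L (B * s + 0)| := by
  have hBL : 3 * L ≤ B * L := Nat.mul_le_mul_right L hB
  have upper : blockMax g L (B * s + 2) ≤ blockMax f L (B * s + 2) + C - δ * (2 * L) := by
    refine blockMax_le hL fun k hk => ?_
    have h1 := hfg (2 * L + k) (by omega)
    have h2 := le_blockMax f (s := B * s + 2) hk
    have e : s * (B * L) + (2 * L + k) = (B * s + 2) * L + k := by ring
    rw [e] at h1
    rw [h1]
    push_cast
    have : 0 ≤ δ * k := by positivity
    linarith
  have lower : blockMax f L (B * s + 0) ≤ blockMax g L (B * s + 0) - C + δ * L := by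
    refine blockMax_le hL fun k hk => ?_
    have h1 := hfg k (by omega)
    have h2 := le_blockMax g (s := B * s + 0) hk
    have e : s * (B * L) + k = (B * s + 0) * L + k := by ring
    rw [e] at h1
    have : δ * k ≤ δ * L := by gcongr
    linarith
  have h1 := le_abs_self (blockMax f L (B * s + 2) - blockMax f L (B * s + 0))
  have h2 := neg_abs_le (blockMax g L (B * s + 2) - blockMax g L (B * s + 0))
  linarith

lemma sum_range_mul_eq (g : ℕ → ℝ) (a w : ℕ) :
    ∑ x ∈ range (a * w), g x = ∑ c ∈ range a, ∑ i ∈ range w, g (c * w + i) := by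
  induction a with
  | zero => simp
  | succ a ih => rw [Nat.succ_mul, sum_range_add, sum_range_succ, ih]

/-- Discrepancy at `(x, j)` of the points `(u n, v n)` in the grid of side `K`. -/
noncomputable def gridDisc {N : ℕ} (u v : Fin N → ℕ) (K x j : ℕ) : ℝ :=
  (∑ n, if u n < x ∧ v n < j then (1 : ℝ) else 0) - N * x * j / K ^ 2

lemma exists_gridDisc_add_eq {N : ℕ} (u v : Fin N → ℕ) (K x h a W : ℕ)
    (hempty : ∀ n, ¬ ((x ≤ u n ∧ u n < x + h) ∧ (a ≤ v n ∧ v n < a + W))) :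
    ∃ C : ℝ, ∀ j < W, gridDisc u v K (x + h) (a + j)
      = gridDisc u v K x (a + j) + C - (N * h / K ^ 2) * j := by
  refine ⟨(∑ n, if (x ≤ u n ∧ u n < x + h) ∧ v n < a then (1 : ℝ) else 0)
    - N * h / K ^ 2 * a, fun j hj => ?_⟩
  have key : (∑ n, if u n < x + h ∧ v n < a + j then (1 : ℝ) else 0)
      = (∑ n, if u n < x ∧ v n < a + j then (1 : ℝ) else 0)
        + ∑ n, if (x ≤ u n ∧ u n < x + h) ∧ v n < a then (1 : ℝ) else 0 := by
    rw [← sum_add_distrib]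
    refine sum_congr rfl fun n _ => ?_
    have := hempty n
    split_ifs <;> first | omega | norm_num
  unfold gridDisc
  rw [key]
  push_cast
  ring

/-- If there are at least twice as many boxes as points, then half of the boxes contain no point. -/
lemma half_le_card_empty_boxes {N : ℕ} (u v : Fin N → ℕ) (a a' w w' : ℕ) (hN : 2 * N ≤ a * a') :
    ((a * a' : ℕ) : ℝ) / 2 ≤ #((range a ×ˢ range a') \ univ.image fun n => (u n / w, v n / w')) := by
  have h1 := le_card_sdiff (univ.image fun n => (u n / w, v n / w')) (range a ×ˢ range a')
  have h2 : #(univ.image fun n => (u n / w, v n / w')) ≤ N := by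
    simpa using card_image_le (s := univ) (f := fun n => (u n / w, v n / w'))
  rw [card_product, card_range, card_range] at h1
  have h3 : a * a' ≤ 2 * #((range a ×ˢ range a') \ univ.image fun n => (u n / w, v n / w')) := by
    omega
  have h4 : ((a * a' : ℕ) : ℝ)
      ≤ 2 * #((range a ×ˢ range a') \ univ.image fun n => (u n / w, v n / w')) := by
    exact_mod_cast h3
  linarith

/-- The gain in one column-cell of a strip that is free of points. -/
lemma empty_box_gain {N : ℕ} (u v : Fin N → ℕ) {B L h : ℕ} (K c s : ℕ) (hB : 3 ≤ B) (hL : 0 < L)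
    (hempty : ∀ n, (u n / (B * h), v n / (B * L)) ≠ (c, s)) :
    h * (N * h / K ^ 2 * L : ℝ) ≤ ∑ i ∈ range (B * h),
      |blockMax (gridDisc u v K (c * (B * h) + i)) L (B * s + 2)
        - blockMax (gridDisc u v K (c * (B * h) + i)) L (B * s + 0)| := by
  set g : ℕ → ℝ := fun i => |blockMax (gridDisc u v K (c * (B * h) + i)) L (B * s + 2)
        - blockMax (gridDisc u v K (c * (B * h) + i)) L (B * s + 0)| with hg
  have h2 : h + h ≤ B * h := by nlinarith
  calc h * (N * h / K ^ 2 * L : ℝ) = ∑ _i ∈ range h, (N * h / K ^ 2 * L : ℝ) := by simp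
    _ ≤ ∑ i ∈ range h, (g i + g (h + i)) := by
        refine sum_le_sum fun i hi => ?_
        have hi := mem_range.1 hi
        obtain ⟨C, hC⟩ := exists_gridDisc_add_eq u v K (c * (B * h) + i) h (s * (B * L)) (B * L)
          (by
            rintro n ⟨⟨h1, h3⟩, h4, h5⟩
            refine hempty n (Prod.mk.injEq .. ▸ ⟨?_, ?_⟩)
            · refine Nat.div_eq_of_lt_le (by omega) ?_
              rw [Nat.succ_mul]
              omega
            · refine Nat.div_eq_of_lt_le (by omega) ?_
              rw [Nat.succ_mul]
              omega)
        have := mul_le_abs_add_abs_of_affine hL hB (by positivity) hC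
        rwa [add_assoc (c * (B * h)) i h, add_comm i h] at this
    _ = ∑ i ∈ range (h + h), g i := by rw [sum_range_add, sum_add_distrib]
    _ ≤ ∑ i ∈ range (B * h), g i :=
        sum_le_sum_of_subset_of_nonneg (range_mono h2) fun i _ _ => abs_nonneg _

lemma total_gain {N : ℕ} (u v : Fin N → ℕ) {B L h K : ℕ} (hB : 3 ≤ B) (hL : 0 < L)
    (hK : K = (L * B) * (B * h)) (hN : 2 * N ≤ K) :
    (K : ℝ) / 2 * (h * (N * h / K ^ 2 * L)) ≤ ∑ x ∈ range K, ∑ s ∈ range (B * h),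
      |blockMax (gridDisc u v K x) L (B * s + 2) - blockMax (gridDisc u v K x) L (B * s + 0)| := by
  set E := (range (L * B) ×ˢ range (B * h)) \
    univ.image fun n => (u n / (B * h), v n / (B * L)) with hE
  set G : ℕ → ℕ → ℝ := fun x s => |blockMax (gridDisc u v K x) L (B * s + 2)
    - blockMax (gridDisc u v K x) L (B * s + 0)| with hG
  have hcard : (K : ℝ) / 2 ≤ #E := by
    have := half_le_card_empty_boxes u v (L * B) (B * h) (B * h) (B * L) (hK ▸ hN)
    rwa [← hK] at this
  have hrw : ∑ x ∈ range K, ∑ s ∈ range (B * h), G x s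
      = ∑ q ∈ range (L * B) ×ˢ range (B * h),
          ∑ i ∈ range (B * h), G (q.1 * (B * h) + i) q.2 := by
    rw [sum_product, hK, sum_range_mul_eq]
    exact sum_congr rfl fun c _ => sum_comm
  calc (K : ℝ) / 2 * (h * (N * h / K ^ 2 * L)) ≤ #E * (h * (N * h / K ^ 2 * L)) := by gcongr
    _ = ∑ _q ∈ E, (h * (N * h / K ^ 2 * L) : ℝ) := by rw [sum_const, nsmul_eq_mul]
    _ ≤ ∑ q ∈ E, ∑ i ∈ range (B * h), G (q.1 * (B * h) + i) q.2 := by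
        refine sum_le_sum fun q hq => empty_box_gain u v K q.1 q.2 hB hL fun n hn => ?_
        exact (mem_sdiff.1 hq).2 (mem_image.2 ⟨n, mem_univ _, hn⟩)
    _ ≤ _ := by
        rw [hrw]
        exact sum_le_sum_of_subset_of_nonneg sdiff_subset fun q _ _ =>
          sum_nonneg fun i _ => abs_nonneg _

/-- Passing to strips longer by a factor `B` increases the mean strip maximum by a constant. -/
lemma sum_blockMax_step {N : ℕ} (u v : Fin N → ℕ) {B L h K : ℕ} (hB : 3 ≤ B) (hL : 0 < L)
    (hh : 0 < h) (hK : K = (L * B) * (B * h)) (hN : 2 * N ≤ K) :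
    L * ∑ x ∈ range K, ∑ s ∈ range (B * (B * h)), blockMax (gridDisc u v K x) L s
        + N * K / (2 * B ^ 4)
      ≤ (B * L : ℕ) * ∑ x ∈ range K, ∑ s ∈ range (B * h),
          blockMax (gridDisc u v K x) (B * L) s := by
  have h1 := total_gain u v hB hL hK hN
  have h2 : ∑ x ∈ range K, ∑ s ∈ range (B * (B * h)), blockMax (gridDisc u v K x) L s
      + ∑ x ∈ range K, ∑ s ∈ range (B * h), |blockMax (gridDisc u v K x) L (B * s + 2)
          - blockMax (gridDisc u v K x) L (B * s + 0)|
      ≤ B * ∑ x ∈ range K, ∑ s ∈ range (B * h), blockMax (gridDisc u v K x) (B * L) s := by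
    rw [← sum_add_distrib, mul_sum]
    refine sum_le_sum fun x _ => ?_
    rw [mul_comm B (B * h), sum_range_mul_eq, ← sum_add_distrib, mul_sum]
    refine sum_le_sum fun s _ => ?_
    simpa only [mul_comm s B] using sum_blockMax_add_abs_le (gridDisc u v K x) s hL hB
  have hB0 : (B : ℝ) ≠ 0 := by positivity
  have hgain : (L : ℝ) * (K / 2 * (h * (N * h / K ^ 2 * L))) = N * K / (2 * B ^ 4) := by
    rw [hK]
    push_cast
    field_simp
  have hL' : (0 : ℝ) ≤ L := by positivity
  have h3 := mul_le_mul_of_nonneg_left (add_le_add_right h1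
    (∑ x ∈ range K, ∑ s ∈ range (B * (B * h)), blockMax (gridDisc u v K x) L s)) hL'
  have h4 := mul_le_mul_of_nonneg_left h2 hL'
  rw [mul_add, hgain] at h3
  push_cast
  linarith

lemma sum_blockMax_iterate {N : ℕ} (u v : Fin N → ℕ) {B K : ℕ} (t k : ℕ) (hB : 3 ≤ B)
    (hK : K = B ^ (t + k + 1)) (hN : 2 * N ≤ K) :
    ∑ x ∈ range K, ∑ s ∈ range K, blockMax (gridDisc u v K x) 1 s + t * (N * K / (2 * B ^ 4))
      ≤ (B ^ t : ℕ) * ∑ x ∈ range K, ∑ s ∈ range (B ^ (k + 1)),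
          blockMax (gridDisc u v K x) (B ^ t) s := by
  induction t generalizing k with
  | zero => simp [hK]
  | succ t ih =>
    have h1 := ih (k + 1) (by rw [hK]; congr 1; ring)
    have h2 := sum_blockMax_step u v (L := B ^ t) (h := B ^ k) hB (by positivity) (by positivity)
      (by rw [hK]; ring) hN
    have e1 : B * (B * B ^ k) = B ^ (k + 1 + 1) := by ring
    have e2 : B * B ^ k = B ^ (k + 1) := by ring
    have e3 : B * B ^ t = B ^ (t + 1) := by ring
    rw [e1, e2, e3] at h2
    push_cast at h1 h2 ⊢
    linarith

lemma le_of_abs_gridDisc_le {N : ℕ} (u v : Fin N → ℕ) {B K t : ℕ} {m : ℝ} (hB : 3 ≤ B)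
    (hK : K = B ^ (t + 1)) (hN : 2 * N ≤ K)
    (hm : ∀ x < K, ∀ j < K, |gridDisc u v K x j| ≤ m) :
    t * N / (4 * B ^ 4 * K) ≤ m := by
  have h := sum_blockMax_iterate u v t 0 hB hK hN
  have lower : -(K * (K * m)) ≤ ∑ x ∈ range K, ∑ s ∈ range K, blockMax (gridDisc u v K x) 1 s := by
    have : ∑ _x ∈ range K, ∑ _s ∈ range K, (-m) = -(K * (K * m)) := by simp
    rw [← this]
    refine sum_le_sum fun x hx => sum_le_sum fun s hs => ?_
    have h1 := le_blockMax (gridDisc u v K x) (L := 1) (s := s) (i := 0) one_pos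
    have h2 := hm x (mem_range.1 hx) s (mem_range.1 hs)
    simp only [mul_one, add_zero] at h1
    linarith [(abs_le.1 h2).1]
  have upper : ((B ^ t : ℕ) : ℝ) * ∑ x ∈ range K, ∑ s ∈ range (B ^ (0 + 1)),
      blockMax (gridDisc u v K x) (B ^ t) s ≤ K * (K * m) := by
    have e : ((B ^ t : ℕ) : ℝ) * ∑ _x ∈ range K, ∑ _s ∈ range (B ^ (0 + 1)), m
        = K * (K * m) := by
      simp only [sum_const, card_range, nsmul_eq_mul]
      rw [hK]
      push_cast
      ring
    rw [← e]
    refine mul_le_mul_of_nonneg_left (sum_le_sum fun x hx => sum_le_sum fun s hs =>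
      blockMax_le (by positivity) fun i hi => ?_) (by positivity)
    refine (abs_le.1 (hm x (mem_range.1 hx) _ ?_)).2
    have hs : s + 1 ≤ B := by simpa using hs
    calc s * B ^ t + i < (s + 1) * B ^ t := by rw [Nat.succ_mul]; omega
      _ ≤ B * B ^ t := Nat.mul_le_mul_right _ hs
      _ = K := by rw [hK]; ring
  have hK0 : (0 : ℝ) < K := by rw [hK]; positivity
  have hB0 : (0 : ℝ) < B := by positivity
  have h3 : t * (N * K / (2 * B ^ 4)) ≤ 2 * (K * (K * m)) := by linarith
  have e : (t * (N * K / (2 * B ^ 4)) : ℝ) = 2 * (K * (K * (t * N / (4 * B ^ 4 * K)))) := by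
    field_simp
    norm_num
  rw [e] at h3
  have h4 : 0 < 2 * ((K : ℝ) * K) := by positivity
  refine le_of_mul_le_mul_left ?_ h4
  linarith

/-- The discrepancy at a point of a coarser grid, in terms of integer parts. -/
lemma sum_indicator_sub_eq_gridDisc {N K Q : ℕ} (hK : 0 < K) (hQ : 0 < Q) (p : Fin N → Fin 2 → ℝ)
    (hp : ∀ n i, p n i ∈ Set.Ico (0 : ℝ) 1) (x j : ℕ) :
    (∑ n, Set.indicator
        {y : Fin 2 → ℝ | y 0 ∈ Set.Ico (0 : ℝ) (((x * Q : ℕ) : ℝ) / (K * Q : ℕ)) ∧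
          y 1 ∈ Set.Ico (0 : ℝ) (((j * Q : ℕ) : ℝ) / (K * Q : ℕ))}
        (fun _ => (1 : ℝ)) (p n))
        - N * (((x * Q : ℕ) : ℝ) / (K * Q : ℕ)) * (((j * Q : ℕ) : ℝ) / (K * Q : ℕ))
      = gridDisc (fun n => ⌊K * p n 0⌋₊) (fun n => ⌊K * p n 1⌋₊) K x j := by
  have hK' : (0 : ℝ) < K := by exact_mod_cast hK
  have hQ' : (Q : ℝ) ≠ 0 := by positivity
  have hq : ∀ y : ℕ, (((y * Q : ℕ) : ℝ) / (K * Q : ℕ)) = y / K := fun y => by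
    push_cast
    field_simp
  have hfl : ∀ n i, ∀ y : ℕ, p n i ∈ Set.Ico (0 : ℝ) (y / K) ↔ ⌊K * p n i⌋₊ < y := by
    intro n i y
    have h0 := (hp n i).1
    rw [Nat.floor_lt (by positivity), Set.mem_Ico, lt_div_iff₀ hK', mul_comm (p n i)]
    exact and_iff_right h0
  simp only [hq, gridDisc, Set.indicator_apply, Set.mem_ofPred_eq, hfl]
  congr 1
  field_simp

lemma le_abs_gridDisc_one_one {N K : ℕ} (u v : Fin N → ℕ) (hN : 2 * N ≤ K ^ 2) :
    (N : ℝ) / K ^ 2 ≤ |gridDisc u v K 1 1| := by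
  have hle : (N : ℝ) / K ^ 2 ≤ 1 / 2 := by
    rcases Nat.eq_zero_or_pos K with h | h
    · simp [h]
    · rw [div_le_div_iff₀ (by positivity) (by norm_num)]
      have : (2 * N : ℝ) ≤ K ^ 2 := by exact_mod_cast hN
      linarith
  have h0 : 0 ≤ (N : ℝ) / K ^ 2 := by positivity
  unfold gridDisc
  rw [sum_boole, Nat.cast_one, mul_one, mul_one]
  rcases Nat.eq_zero_or_pos #{n | u n < 1 ∧ v n < 1} with h | h
  · rw [h, Nat.cast_zero, zero_sub, abs_neg]
    exact le_abs_self _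
  · have : (1 : ℝ) ≤ #{n | u n < 1 ∧ v n < 1} := by exact_mod_cast h
    exact le_trans (by linarith) (le_abs_self _)

/-- Discrete version of Schmidt's theorem in dimension 2: some anchored box with
vertex on the grid has discrepancy at least `c̃·log N`. -/
theorem stmt4 (b : ℕ) (hb : 2 ≤ b) :
    ∃ c : ℝ, 0 < c ∧
      ∀ (N ν τ M : ℕ), 2 ≤ N → b ^ (ν - 2) ≤ N → N < b ^ (ν - 1) → 1 ≤ τ →
        M = b ^ (ν + τ) →
        ∀ p : Fin N → Fin 2 → ℝ, (∀ n i, p n i ∈ Set.Ico (0 : ℝ) 1) →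
          ∃ j₁ ∈ Finset.Icc 1 M, ∃ j₂ ∈ Finset.Icc 1 M,
            c * Real.log N ≤
              |(∑ n, Set.indicator
                  {y : Fin 2 → ℝ | y 0 ∈ Set.Ico (0 : ℝ) ((j₁ : ℝ) / M) ∧
                    y 1 ∈ Set.Ico (0 : ℝ) ((j₂ : ℝ) / M)}
                  (fun _ => (1 : ℝ)) (p n)) - N * ((j₁ : ℝ) / M) * ((j₂ : ℝ) / M)| := by
  have hb1 : (1 : ℝ) < b := by exact_mod_cast hb
  have hlogb : 0 < Real.log b := Real.log_pos hb1
  refine ⟨1 / (24 * b ^ 11 * Real.log b), by positivity, ?_⟩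
  intro N ν τ M hN2 hNlow hNup hτ hM p hp
  have hν : 2 ≤ ν := by
    by_contra! h
    have : ν - 1 = 0 := by omega
    rw [this] at hNup
    simp at hNup
    omega
  have hlogN : Real.log N ≤ (ν - 1 : ℕ) * Real.log b := by
    rw [← Real.log_pow]
    refine Real.log_le_log (by positivity) ?_
    exact_mod_cast hNup.le
  have hbound : 1 / (24 * b ^ 11 * Real.log b) * Real.log N ≤ (ν - 1 : ℕ) / (24 * b ^ 11) := by
    calc 1 / (24 * b ^ 11 * Real.log b) * Real.log N
        ≤ 1 / (24 * b ^ 11 * Real.log b) * ((ν - 1 : ℕ) * Real.log b) := by gcongr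
      _ = ((ν - 1 : ℕ) : ℝ) / (24 * (b : ℝ) ^ 11) := by field_simp
  have hsub : ∀ k ≤ ν + τ, b ^ k * b ^ (ν + τ - k) = M := fun k hk => by
    rw [hM, ← pow_add, Nat.add_sub_cancel' hk]
  have hmem : ∀ k ≤ ν + τ, ∀ x, 1 ≤ x → x ≤ b ^ k → x * b ^ (ν + τ - k) ∈ Icc 1 M := by
    intro k hk x h1 h2
    rw [mem_Icc, ← hsub k hk]
    exact ⟨Nat.one_le_iff_ne_zero.2 (by positivity), Nat.mul_le_mul_right _ h2⟩
  rcases hν.eq_or_lt with rfl | hν3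
  · have h1 : 1 * b ^ (2 + τ - 1) ∈ Icc 1 M := hmem 1 (by omega) 1 le_rfl (by simp; omega)
    refine ⟨_, h1, _, h1, ?_⟩
    rw [← hsub 1 (by omega), sum_indicator_sub_eq_gridDisc (by positivity) (by positivity) p hp]
    have hNb : N < b := by simpa using hNup
    refine le_trans ?_ (le_abs_gridDisc_one_one _ _ ?_)
    · refine hbound.trans ?_
      push_cast
      rw [div_le_div_iff₀ (by positivity) (by positivity)]
      have hN1 : (1 : ℝ) ≤ N := by exact_mod_cast (by omega : 1 ≤ N)
      have : (b : ℝ) ^ 2 ≤ b ^ 11 := pow_le_pow_right₀ hb1.le (by norm_num)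
      have h11 : (0 : ℝ) ≤ b ^ 11 := by positivity
      norm_num
      nlinarith
    · rw [pow_one]
      nlinarith
  · by_contra! hcon
    obtain ⟨t, ht1, ht2⟩ : ∃ t, ν - 1 ≤ 3 * t ∧ (ν ≤ 2 * (t + 1) ∧ 2 * (t + 1) ≤ ν + 1) :=
      ⟨(ν - 1) / 2, by omega, by omega, by omega⟩
    set K := b ^ (2 * (t + 1)) with hKdef
    have hk : 2 * (t + 1) ≤ ν + τ := by omega
    have hNK : 2 * N ≤ K := by
      calc 2 * N ≤ b * b ^ (ν - 1) := Nat.mul_le_mul hb hNup.le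
        _ = b ^ ν := by rw [← pow_succ']; congr 1; omega
        _ ≤ K := Nat.pow_le_pow_right (by omega) ht2.1
    have hKN : K ≤ b ^ 3 * N := by
      calc K ≤ b ^ (ν + 1) := Nat.pow_le_pow_right (by omega) ht2.2
        _ = b ^ 3 * b ^ (ν - 2) := by rw [← pow_add]; congr 1; omega
        _ ≤ b ^ 3 * N := Nat.mul_le_mul_left _ hNlow
    have hm : ∀ x < K, ∀ j < K,
        |gridDisc (fun n => ⌊K * p n 0⌋₊) (fun n => ⌊K * p n 1⌋₊) K x j|
          ≤ (ν - 1 : ℕ) / (24 * b ^ 11) := by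
      intro x hx j hj
      rcases Nat.eq_zero_or_pos x with rfl | hx0
      · simp only [gridDisc, not_lt_zero, false_and, if_false, sum_const_zero, Nat.cast_zero,
          mul_zero, zero_mul, zero_div, sub_zero, abs_zero]
        positivity
      rcases Nat.eq_zero_or_pos j with rfl | hj0
      · simp only [gridDisc, not_lt_zero, and_false, if_false, sum_const_zero, Nat.cast_zero,
          mul_zero, zero_div, sub_zero, abs_zero]
        positivity
      have h := hcon _ (hmem _ hk x hx0 hx.le) _ (hmem _ hk j hj0 hj.le)
      rw [← hsub _ hk, sum_indicator_sub_eq_gridDisc (by positivity) (by positivity) p hp] at h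
      exact h.le.trans hbound
    have hfin := le_of_abs_gridDisc_le _ _ (B := b ^ 2) (t := t) (by nlinarith)
      (by rw [hKdef, pow_mul]) hNK hm
    have hK0 : (0 : ℝ) < K := by rw [hKdef]; push_cast; positivity
    have hKN' : (K : ℝ) ≤ b ^ 3 * N := by exact_mod_cast hKN
    have h1 : (t : ℝ) / (4 * b ^ 11) ≤ t * N / (4 * (b ^ 2 : ℕ) ^ 4 * K) := by
      push_cast
      rw [div_le_div_iff₀ (by positivity) (by positivity)]
      calc (t : ℝ) * (4 * (b ^ 2) ^ 4 * K) ≤ t * (4 * (b ^ 2) ^ 4 * (b ^ 3 * N)) := by gcongr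
        _ = (t : ℝ) * N * (4 * (b : ℝ) ^ 11) := by ring
    have h2 : ((ν - 1 : ℕ) : ℝ) / (24 * b ^ 11) < t / (4 * b ^ 11) := by
      have h3 : ((ν - 1 : ℕ) : ℝ) ≤ 3 * t := by exact_mod_cast ht1
      have h4 : (0 : ℝ) < t := by exact_mod_cast (by omega : 0 < t)
      have h11 : (0 : ℝ) < b ^ 11 := by positivity
      rw [div_lt_div_iff₀ (by positivity) (by positivity)]
      nlinarith [mul_pos h4 h11]
    linarith
end

section
/- There exists a constant c > 0 such that for every positive integer N, every even integer M ≥ 18dN, and every finite sequence P_N = {p_n}_{n=1}^N in 𝕋^d, the average (card(J_M)^{-d}·card(S_M)^{-1}·Σ_{j∈J_M^d} Σ_{s∈S_M} |D((j₁/M,...,j_d/M) + Q(s), P_N)|²)^{1/2} is at least c·(log N)^{(d-1)/2}, where D(x + Q(s), P_N) = Σ_n χ_{x+Q(s)}(p_n) - N(2s)^d. -/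
namespace CubeDiscrepancy

open Finset ComplexConjugate

/-- The character `g ↦ e(k · g / M)` of the group `(ℤ/M)^ι`. -/
noncomputable def torusChar {ι : Type*} [Fintype ι] {M : ℕ} [NeZero M] (k g : ι → ZMod M) : ℂ :=
  ∏ i, ZMod.stdAddChar (k i * g i)

/-- The exponential sum of the points `a n` at the frequency `k`. -/
noncomputable def expSum {ι ν : Type*} [Fintype ι] [Fintype ν] {M : ℕ} [NeZero M]
    (a : ν → ι → ZMod M) (k : ι → ZMod M) : ℂ :=
  ∑ n, torusChar k (a n)

section Characters

variable {ι ν : Type*} [Fintype ι] [Fintype ν] {M : ℕ} [NeZero M]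

lemma torusChar_comm (k g : ι → ZMod M) : torusChar k g = torusChar g k := by
  simp [torusChar, mul_comm]

lemma torusChar_sub_right (k g h : ι → ZMod M) :
    torusChar k (g - h) = torusChar k g * conj (torusChar k h) := by
  simp only [torusChar, map_prod, ← prod_mul_distrib]
  refine prod_congr rfl fun i _ => ?_
  rw [← AddChar.map_neg_eq_conj, ← AddChar.map_add_eq_mul, Pi.sub_apply]
  ring_nf

lemma torusChar_sub_left (k l g : ι → ZMod M) :
    torusChar (k - l) g = torusChar k g * conj (torusChar l g) := by
  rw [torusChar_comm, torusChar_sub_right, torusChar_comm g k, torusChar_comm g l]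

@[simp] lemma torusChar_zero_left (g : ι → ZMod M) : torusChar 0 g = 1 := by
  simp [torusChar]

@[simp] lemma torusChar_zero_right (k : ι → ZMod M) : torusChar k 0 = 1 := by
  simp [torusChar]

lemma sum_torusChar [DecidableEq ι] (g : ι → ZMod M) :
    ∑ k, torusChar k g = if g = 0 then (M : ℂ) ^ Fintype.card ι else 0 := by
  have h : ∑ k, torusChar k g = ∏ i, ∑ x : ZMod M, ZMod.stdAddChar (x * g i) := by
    rw [prod_univ_sum, Fintype.piFinset_univ]
    rfl
  simp_rw [h, AddChar.sum_mulShift _ (ZMod.isPrimitive_stdAddChar M), ZMod.card]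
  split_ifs with hg
  · simp [hg]
  · obtain ⟨i, hi⟩ := Function.ne_iff.1 hg
    exact prod_eq_zero (mem_univ i) (by rw [if_neg (by simpa using hi), Nat.cast_zero])

/-- Parseval's identity on `(ℤ/M)^ι`. -/
lemma sum_norm_sq_transform [DecidableEq ι] (f : (ι → ZMod M) → ℝ) :
    ∑ k, ‖∑ g, (f g : ℂ) * torusChar k g‖ ^ 2 = (M : ℝ) ^ Fintype.card ι * ∑ g, f g ^ 2 := by
  apply Complex.ofReal_injective
  push_cast
  simp_rw [← Complex.mul_conj', map_sum, map_mul, Complex.conj_ofReal, sum_mul_sum]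
  rw [sum_comm, mul_sum]
  refine sum_congr rfl fun g _ => ?_
  rw [sum_comm]
  have h : ∀ h : ι → ZMod M, ∑ k, (f g : ℂ) * torusChar k g * (f h * conj (torusChar k h))
      = f g * f h * if g = h then (M : ℂ) ^ Fintype.card ι else 0 := by
    intro h
    simp_rw [← sub_eq_zero (a := g), ← sum_torusChar, mul_sum]
    refine sum_congr rfl fun k _ => ?_
    rw [torusChar_sub_right]
    ring
  simp_rw [h]
  simp
  ring

@[simp] lemma expSum_zero (a : ν → ι → ZMod M) : expSum a 0 = Fintype.card ν := by
  simp [expSum]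

/-- Summing `|S(l - l')|²` over pairs of frequencies in `B` gives a nonnegative kernel in the
points whose diagonal alone contributes `N |B|²`. -/
lemma card_mul_card_sq_le_sum_expSum (a : ν → ι → ZMod M) (B : Finset (ι → ZMod M)) :
    (Fintype.card ν : ℝ) * #B ^ 2 ≤ ∑ l' ∈ B, ∑ l ∈ B, ‖expSum a (l - l')‖ ^ 2 := by
  have key : ∑ l' ∈ B, ∑ l ∈ B, ‖expSum a (l - l')‖ ^ 2
      = ∑ n, ∑ m, ‖∑ l ∈ B, torusChar l (a n - a m)‖ ^ 2 := by
    apply Complex.ofReal_injective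
    push_cast
    simp_rw [← Complex.mul_conj', expSum, map_sum, sum_mul_sum]
    simp_rw [sum_comm (s := B) (t := univ)]
    refine sum_congr rfl fun n _ => sum_congr rfl fun m _ => ?_
    rw [sum_comm]
    refine sum_congr rfl fun l _ => sum_congr rfl fun l' _ => ?_
    simp only [torusChar_sub_left, torusChar_sub_right, map_mul, Complex.conj_conj]
    ring
  rw [key]
  calc (Fintype.card ν : ℝ) * #B ^ 2 = ∑ n : ν, ‖∑ l ∈ B, torusChar l (a n - a n)‖ ^ 2 := by
        simp
    _ ≤ _ := sum_le_sum fun n _ =>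
        single_le_sum (f := fun m => ‖∑ l ∈ B, torusChar l (a n - a m)‖ ^ 2)
          (fun m _ => by positivity) (mem_univ n)

lemma card_mul_card_le_sum_expSum [DecidableEq ι] (a : ν → ι → ZMod M)
    (B C : Finset (ι → ZMod M)) (hB : B.Nonempty) (hC : ∀ l ∈ B, ∀ l' ∈ B, l - l' ∈ C) :
    (Fintype.card ν : ℝ) * #B ≤ ∑ k ∈ C, ‖expSum a k‖ ^ 2 := by
  have h : ∑ l' ∈ B, ∑ l ∈ B, ‖expSum a (l - l')‖ ^ 2
      ≤ ∑ _l' ∈ B, ∑ k ∈ C, ‖expSum a k‖ ^ 2 := by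
    refine sum_le_sum fun l' hl' => ?_
    rw [← sum_image (s := B) (g := fun l => l - l') (f := fun k => ‖expSum a k‖ ^ 2)
      (fun x _ y _ hxy => sub_left_injective hxy)]
    refine sum_le_sum_of_subset_of_nonneg ?_ fun _ _ _ => by positivity
    intro k hk
    obtain ⟨l, hl, rfl⟩ := mem_image.1 hk
    exact hC l hl l' hl'
  rw [sum_const, nsmul_eq_mul] at h
  have hpos : (0 : ℝ) < #B := by exact_mod_cast hB.card_pos
  have := (card_mul_card_sq_le_sum_expSum a B).trans h
  refine le_of_mul_le_mul_left (a := (#B : ℝ)) ?_ hpos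
  linarith [this]

end Characters

section Boxes

variable {M : ℕ} [NeZero M]

lemma natAbs_valMinAbs_sub_lt {r : ℕ} {x y : ZMod M} (hx : x.val < r) (hy : y.val < r) :
    (x - y).valMinAbs.natAbs < r := by
  wlog h : y.val ≤ x.val generalizing x y
  · rw [← neg_sub, ZMod.natAbs_valMinAbs_neg]
    exact this hy hx (by omega)
  · rw [ZMod.valMinAbs_natAbs_eq_min, ZMod.val_sub h]
    omega

lemma card_filter_val_lt {r : ℕ} (hr : r ≤ M) : #{x : ZMod M | x.val < r} = r := by
  conv_rhs => rw [← card_range r]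
  refine card_nbij ZMod.val (fun x hx => by simpa using hx)
    (fun x _ y _ h => ZMod.val_injective M h) fun m hm => ?_
  have hm' : m < r := by simpa using hm
  exact ⟨m, by simp [ZMod.val_cast_of_lt (hm'.trans_le hr), hm'],
    ZMod.val_cast_of_lt (hm'.trans_le hr)⟩

/-- The nonzero frequencies in a box of volume `2 ^ R` carry at least `N (2 ^ R - N)`. -/
lemma le_sum_expSum_box {ι ν : Type*} [Fintype ι] [DecidableEq ι] [Fintype ν]
    (a : ν → ι → ZMod M) {R : ℕ} (hR : 2 ^ R ≤ M) (r : ι → ℕ) (hr : ∑ i, r i = R) :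
    (Fintype.card ν : ℝ) * (2 ^ R - Fintype.card ν)
      ≤ ∑ k ∈ {k : ι → ZMod M | k ≠ 0 ∧ ∀ i, (k i).valMinAbs.natAbs < 2 ^ r i},
          ‖expSum a k‖ ^ 2 := by
  set B : Finset (ι → ZMod M) := Fintype.piFinset fun i => {x : ZMod M | x.val < 2 ^ r i} with hB
  have hle : ∀ i, 2 ^ r i ≤ M := fun i => (Nat.pow_le_pow_right two_pos
    (hr ▸ single_le_sum (fun _ _ => Nat.zero_le _) (mem_univ i))).trans hR
  have hcard : #B = 2 ^ R := by
    rw [hB, Fintype.card_piFinset, ← hr, ← prod_pow_eq_pow_sum]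
    exact prod_congr rfl fun i _ => card_filter_val_lt (hle i)
  have h := card_mul_card_le_sum_expSum a B
    {k : ι → ZMod M | ∀ i, (k i).valMinAbs.natAbs < 2 ^ r i}
    (card_pos.1 (by rw [hcard]; positivity)) (by
      intro l hl l' hl'
      simp only [hB, Fintype.mem_piFinset, mem_filter, mem_univ, true_and] at hl hl' ⊢
      exact fun i => natAbs_valMinAbs_sub_lt (hl i) (hl' i))
  rw [← add_sum_erase _ _ (a := 0) (by simp)] at h
  rw [hcard] at h
  have he : ({k : ι → ZMod M | ∀ i, (k i).valMinAbs.natAbs < 2 ^ r i} : Finset _).erase 0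
      = ({k : ι → ZMod M | k ≠ 0 ∧ ∀ i, (k i).valMinAbs.natAbs < 2 ^ r i} : Finset _) := by
    ext k
    simp
  rw [he] at h
  simp only [expSum_zero, Complex.norm_natCast] at h
  push_cast at h
  linarith

lemma sum_dyadic_tail_le (q n : ℕ) :
    ∑ r ∈ range n, (if q < 2 ^ r then ((1 : ℝ) / 4) ^ r else 0)
      ≤ 4 / 3 * (1 / (max 1 q : ℝ) ^ 2) := by
  suffices h : ∑ r ∈ range n, (if q < 2 ^ r then ((1 : ℝ) / 4) ^ r else 0)
      ≤ 4 / 3 * max 0 (1 / (max 1 q : ℝ) ^ 2 - (1 / 4) ^ n) by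
    refine h.trans ?_
    gcongr
    exact max_le (by positivity) (by linarith [pow_nonneg (by norm_num : (0:ℝ) ≤ 1 / 4) n])
  induction n with
  | zero => simp
  | succ n ih =>
    rw [sum_range_succ]
    split_ifs with hq
    · have h1 : ((1 : ℝ) / 4) ^ n ≤ 1 / (max 1 q : ℝ) ^ 2 := by
        have : (max 1 q : ℝ) ≤ 2 ^ n :=
          max_le (one_le_pow₀ (by norm_num)) (by exact_mod_cast hq.le)
        rw [div_pow, one_pow]
        refine one_div_le_one_div_of_le (by positivity) ?_
        calc (max 1 q : ℝ) ^ 2 ≤ (2 ^ n) ^ 2 := by gcongr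
          _ = 4 ^ n := by rw [← pow_mul, mul_comm, pow_mul]; norm_num
      rw [max_eq_right (by linarith)] at ih
      have := le_max_right 0 (1 / (max 1 q : ℝ) ^ 2 - (1 / 4) ^ (n + 1))
      rw [pow_succ (1 / 4 : ℝ)] at this ⊢
      linarith
    · rw [add_zero]
      refine ih.trans ?_
      gcongr 4 / 3 * max 0 (_ - ?_)
      rw [pow_succ]
      linarith [pow_nonneg (by norm_num : (0:ℝ) ≤ 1 / 4) n]

lemma pow_div_factorial_le_card_piAntidiag {ι : Type*} [Fintype ι] [DecidableEq ι]
    (hι : 0 < Fintype.card ι) (R : ℕ) :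
    (R : ℝ) ^ (Fintype.card ι - 1) / (Fintype.card ι - 1).factorial
      ≤ #(piAntidiag (univ : Finset ι) R) := by
  have hc : #(piAntidiag (univ : Finset ι) R)
      = (R + (Fintype.card ι - 1)).choose (Fintype.card ι - 1) := by
    rw [← map_sym_eq_piAntidiag, card_map, sym_univ, card_univ, Sym.card_sym_eq_multichoose, Nat.multichoose_eq,
      Nat.choose_symm_of_eq_add]
    · congr 1; omega
    · omega
  rw [hc]
  refine le_trans ?_ (Nat.pow_le_choose (α := ℝ) _ _)
  gcongr
  omega

/-- Weighted lower bound for the exponential sums, obtained by summing over all dyadic boxes of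
volume `2 ^ R`. -/
lemma card_piAntidiag_le_sum_expSum {ι ν : Type*} [Fintype ι] [DecidableEq ι] [Fintype ν]
    (a : ν → ι → ZMod M) {R : ℕ} (hR : 2 ^ R ≤ M) :
    (#(piAntidiag (univ : Finset ι) R) : ℝ)
        * ((1 / 4) ^ R * ((Fintype.card ν : ℝ) * (2 ^ R - Fintype.card ν)))
      ≤ ∑ k ∈ {k : ι → ZMod M | k ≠ 0 ∧ ∀ i, (k i).valMinAbs.natAbs < 2 ^ R},
          ‖expSum a k‖ ^ 2 * ∏ i, (4 / 3 * (1 / (max 1 (k i).valMinAbs.natAbs : ℝ) ^ 2)) := by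
  set w : ℕ → ℕ → ℝ := fun q r => if q < 2 ^ r then (1 / 4) ^ r else 0 with hw
  have hw0 : ∀ q r, 0 ≤ w q r := fun q r => by simp only [hw]; split_ifs <;> positivity
  set K : Finset (ι → ZMod M) :=
    {k : ι → ZMod M | k ≠ 0 ∧ ∀ i, (k i).valMinAbs.natAbs < 2 ^ R} with hK
  have hle : ∀ r ∈ piAntidiag (univ : Finset ι) R, ∀ i, r i ≤ R := fun r hr i =>
    (mem_piAntidiag.1 hr).1 ▸ single_le_sum (fun _ _ => Nat.zero_le _) (mem_univ i)
  have hbox : ∀ r ∈ piAntidiag (univ : Finset ι) R,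
      (1 / 4) ^ R * ((Fintype.card ν : ℝ) * (2 ^ R - Fintype.card ν))
        ≤ ∑ k ∈ K, ‖expSum a k‖ ^ 2 * ∏ i, w (k i).valMinAbs.natAbs (r i) := by
    intro r hr
    have hsum := (mem_piAntidiag.1 hr).1
    refine (mul_le_mul_of_nonneg_left (le_sum_expSum_box a hR r hsum) (by positivity)).trans ?_
    have hsub : ({k : ι → ZMod M | k ≠ 0 ∧ ∀ i, (k i).valMinAbs.natAbs < 2 ^ r i} : Finset _)
        ⊆ K := by
      intro k hk
      simp only [hK, mem_filter, mem_univ, true_and] at hk ⊢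
      exact ⟨hk.1, fun i => (hk.2 i).trans_le (Nat.pow_le_pow_right two_pos (hle r hr i))⟩
    refine le_trans ?_ (sum_le_sum_of_subset_of_nonneg hsub fun k _ _ =>
      mul_nonneg (by positivity) (prod_nonneg fun i _ => hw0 _ _))
    rw [mul_sum]
    refine sum_le_sum fun k hk => ?_
    simp only [mem_filter, mem_univ, true_and] at hk
    have : ∏ i, w (k i).valMinAbs.natAbs (r i) = (1 / 4) ^ R := by
      rw [← hsum, ← prod_pow_eq_pow_sum]
      exact prod_congr rfl fun i _ => if_pos (hk.2 i)
    rw [this, mul_comm]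
  calc _ = ∑ _r ∈ piAntidiag (univ : Finset ι) R,
        (1 / 4) ^ R * ((Fintype.card ν : ℝ) * (2 ^ R - Fintype.card ν)) := by
        rw [sum_const, nsmul_eq_mul]
    _ ≤ _ := sum_le_sum hbox
    _ = ∑ k ∈ K, ‖expSum a k‖ ^ 2 * ∑ r ∈ piAntidiag (univ : Finset ι) R,
          ∏ i, w (k i).valMinAbs.natAbs (r i) := by
        rw [sum_comm]
        simp_rw [mul_sum]
    _ ≤ _ := by
        refine sum_le_sum fun k _ => mul_le_mul_of_nonneg_left ?_ (by positivity)
        calc _ ≤ ∑ r ∈ Fintype.piFinset fun _ : ι => range (R + 1),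
              ∏ i, w (k i).valMinAbs.natAbs (r i) :=
              sum_le_sum_of_subset_of_nonneg (fun r hr => Fintype.mem_piFinset.2 fun i =>
                mem_range.2 (Nat.lt_succ_of_le (hle r hr i)))
                fun r _ _ => prod_nonneg fun i _ => hw0 _ _
          _ = ∏ i, ∑ r ∈ range (R + 1), w (k i).valMinAbs.natAbs r := by rw [prod_univ_sum]
          _ ≤ _ := prod_le_prod (fun i _ => sum_nonneg fun r _ => hw0 _ _)
              fun i _ => sum_dyadic_tail_le _ _

end Boxes

lemma two_mul_abs_sub_round_le_abs_sin (x : ℝ) :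
    2 * |x - round x| ≤ |Real.sin (Real.pi * x)| := by
  have h : |Real.sin (Real.pi * x)| = |Real.sin (Real.pi * |x - round x|)| := by
    have h1 : Real.pi * x = Real.pi * (x - round x) + (round x : ℤ) * Real.pi := by ring
    rw [h1, Real.sin_add_int_mul_pi, abs_mul, abs_zpow, abs_neg, abs_one, one_zpow, one_mul]
    rcases abs_cases (x - round x) with ⟨h, _⟩ | ⟨h, _⟩ <;> rw [h]
    rw [mul_neg, Real.sin_neg, abs_neg]
  rw [h]
  refine le_trans ?_ (le_abs_self _)
  have := Real.mul_le_sin (x := Real.pi * |x - round x|) (by positivity)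
    (by nlinarith [abs_sub_round x, Real.pi_pos])
  calc _ = 2 / Real.pi * (Real.pi * |x - round x|) := by field_simp
    _ ≤ _ := this

lemma card_le_floor_add_one {A : Finset ℕ} {L : ℝ}
    (hA : ∀ x ∈ A, ∀ y ∈ A, (y : ℝ) - x ≤ L) : #A ≤ ⌊L⌋₊ + 1 := by
  rcases A.eq_empty_or_nonempty with rfl | hne
  · simp
  have hsub : A ⊆ Icc (A.min' hne) (A.min' hne + ⌊L⌋₊) := by
    intro y hy
    have h1 := A.min'_le y hy
    have h2 : y - A.min' hne ≤ ⌊L⌋₊ := Nat.le_floor (by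
      rw [Nat.cast_sub h1]
      exact hA _ (A.min'_mem hne) y hy)
    rw [mem_Icc]
    omega
  refine (card_le_card hsub).trans ?_
  rw [Nat.card_Icc]
  omega

/-- Few `t < H` make `q t / H` close to an integer. -/
lemma card_filter_abs_sub_round_lt_le {H q : ℕ} (hH : 0 < H) (hq : 0 < q) {δ : ℝ} (hδ : 0 < δ) :
    (#{t ∈ range H | |(q * (t : ℕ) / H : ℝ) - round (q * (t : ℕ) / H : ℝ)| < δ} : ℝ)
      ≤ 4 * δ * H + q + 1 := by
  have hH' : (0 : ℝ) < H := by exact_mod_cast hH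
  have hq' : (1 : ℝ) ≤ q := by exact_mod_cast hq
  have hcard := card_le_mul_card_image_of_maps_to
    (s := {t ∈ range H | |(q * (t : ℕ) / H : ℝ) - round (q * (t : ℕ) / H : ℝ)| < δ})
    (f := fun t : ℕ => round (q * t / H : ℝ)) (t := Icc (0 : ℤ) q) (by
      intro t ht
      have ht' : (t : ℝ) ≤ H := by
        exact_mod_cast (mem_range.1 (mem_filter.1 ht).1).le
      have h0 : (0 : ℝ) ≤ q * t / H := by positivity
      have h1 : (q * t / H : ℝ) ≤ q := by
        rw [div_le_iff₀ hH']
        gcongr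
      have hr := abs_le.1 (abs_sub_round (q * t / H : ℝ))
      rw [mem_Icc]
      constructor
      · have : (-1 : ℝ) < round (q * t / H : ℝ) := by linarith
        have : (-1 : ℤ) < round (q * t / H : ℝ) := by exact_mod_cast this
        omega
      · have : (round (q * t / H : ℝ) : ℝ) < q + 1 := by linarith
        have : round (q * t / H : ℝ) < (q : ℤ) + 1 := by exact_mod_cast this
        omega) (⌊2 * δ * H / q⌋₊ + 1) (by
      intro m _
      refine card_le_floor_add_one ?_
      intro x hx y hy
      simp only [mem_filter] at hx hy
      rw [hx.2] at hx
      rw [hy.2] at hy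
      have h1 := (abs_lt.1 hx.1.2).1
      have h2 := (abs_lt.1 hy.1.2).2
      rw [le_div_iff₀ (by positivity)]
      have h3 : (q * y / H : ℝ) - q * x / H ≤ 2 * δ := by linarith
      rw [← sub_div, div_le_iff₀ hH'] at h3
      linarith)
  have hfl : (⌊2 * δ * H / q⌋₊ : ℝ) ≤ 2 * δ * H / q := Nat.floor_le (by positivity)
  have hIcc : #(Icc (0 : ℤ) q) = q + 1 := by simp
  rw [hIcc] at hcard
  have hcard' : (#{t ∈ range H | |(q * (t : ℕ) / H : ℝ) - round (q * (t : ℕ) / H : ℝ)| < δ} : ℝ)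
      ≤ (⌊2 * δ * H / q⌋₊ + 1) * (q + 1) := by exact_mod_cast hcard
  refine hcard'.trans ?_
  calc ((⌊2 * δ * H / q⌋₊ : ℝ) + 1) * (q + 1) ≤ (2 * δ * H / q + 1) * (q + 1) := by gcongr
    _ = 2 * δ * H + 2 * δ * H / q + q + 1 := by field_simp; ring
    _ ≤ 2 * δ * H + 2 * δ * H + q + 1 := by
        gcongr
        exact div_le_self (by positivity) hq'
    _ = _ := by ring

/-- The indicator of the arc `[-t, t)` in `ℤ/M`. -/
def arc {M : ℕ} (t : ℕ) (u : ZMod M) : ℝ := if (u + t).val < 2 * t then 1 else 0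

/-- The Fourier coefficient of `arc t` at the frequency `k`. -/
noncomputable def arcCoeff {M : ℕ} [NeZero M] (t : ℕ) (k : ZMod M) : ℂ :=
  ∑ u, (arc t u : ℂ) * ZMod.stdAddChar (-(k * u))

section Arc

variable {M : ℕ} [NeZero M]

lemma sum_val_lt {r : ℕ} (hr : r ≤ M) (f : ZMod M → ℂ) :
    ∑ v : ZMod M, (if v.val < r then f v else 0) = ∑ m ∈ range r, f m := by
  rw [← sum_filter]
  refine sum_bij' (fun v _ => v.val) (fun m _ => (m : ZMod M)) ?_ ?_ ?_ ?_ ?_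
  · intro v hv; simpa using hv
  · intro m hm
    have hm := mem_range.1 hm
    simp [ZMod.val_cast_of_lt (hm.trans_le hr), hm]
  · intro v _; simp
  · intro m hm
    exact ZMod.val_cast_of_lt ((mem_range.1 hm).trans_le hr)
  · intro v _; simp

lemma norm_arcCoeff {t : ℕ} (ht : 2 * t ≤ M) (k : ZMod M) :
    ‖arcCoeff t k‖ = ‖∑ m ∈ range (2 * t), ZMod.stdAddChar (-k) ^ m‖ := by
  have h : arcCoeff t k
      = ZMod.stdAddChar (k * (t : ZMod M)) * ∑ m ∈ range (2 * t), ZMod.stdAddChar (-k) ^ m := by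
    rw [arcCoeff, ← (Equiv.subRight (t : ZMod M)).sum_comp]
    simp_rw [← AddChar.map_nsmul_eq_pow]
    have := sum_val_lt ht fun v => ZMod.stdAddChar (k * (t : ZMod M)) * ZMod.stdAddChar (-k * v)
    rw [← mul_sum] at this
    simp only [nsmul_eq_mul, mul_comm _ (-k)]
    rw [← this]
    refine sum_congr rfl fun v _ => ?_
    simp only [Equiv.subRight_apply, arc, sub_add_cancel]
    split_ifs
    · rw [← AddChar.map_add_eq_mul]
      push_cast
      rw [one_mul]
      ring_nf
    · simp
  rw [h, norm_mul, AddChar.norm_apply, one_mul]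

lemma norm_arcCoeff_zero {t : ℕ} (ht : 2 * t ≤ M) : ‖arcCoeff t (0 : ZMod M)‖ = 2 * t := by
  rw [norm_arcCoeff ht]
  simp

lemma stdAddChar_neg_eq_exp (k : ZMod M) (m : ℕ) :
    ZMod.stdAddChar (-k) ^ m
      = Complex.exp (Complex.I * ((-(2 * Real.pi * k.valMinAbs * m / M) : ℝ) : ℂ)) := by
  have h : -k = ((-k.valMinAbs : ℤ) : ZMod M) := by simp
  rw [h, ZMod.stdAddChar_coe, ← Complex.exp_nat_mul]
  congr 1
  push_cast
  ring

lemma le_norm_arcCoeff {H t : ℕ} (hM : M = 2 * H) (ht : t ≤ H) {k : ZMod M} (hk : k ≠ 0) {δ : ℝ}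
    (hδ : δ ≤ |(k.valMinAbs.natAbs * t / H : ℝ) - round (k.valMinAbs.natAbs * t / H : ℝ)|) :
    2 * δ / Real.pi * M / k.valMinAbs.natAbs ≤ ‖arcCoeff t k‖ := by
  have hMpos : (0 : ℝ) < M := by exact_mod_cast NeZero.pos M
  have hH : (H : ℝ) = M / 2 := by rw [hM]; push_cast; ring
  set q := k.valMinAbs.natAbs with hq
  have hqpos : (0 : ℝ) < q := by
    have : 0 < q := Int.natAbs_pos.2 ((ZMod.valMinAbs_eq_zero k).not.2 hk)
    exact_mod_cast this
  have hqa : |(k.valMinAbs : ℝ)| = q := by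
    rw [hq, Nat.cast_natAbs]; simp
  have hgeom := geom_sum_mul (ZMod.stdAddChar (-k) : ℂ) (2 * t)
  have hnorm := congrArg norm hgeom
  rw [norm_mul, ← norm_arcCoeff (by omega)] at hnorm
  have hup : ‖(ZMod.stdAddChar (-k) : ℂ) - 1‖ ≤ 2 * Real.pi * q / M := by
    have h := stdAddChar_neg_eq_exp k 1
    rw [pow_one] at h
    rw [h]
    refine Real.norm_exp_I_mul_ofReal_sub_one_le.trans_eq ?_
    rw [norm_neg, Real.norm_eq_abs, abs_div, abs_mul, abs_mul, hqa, abs_of_pos hMpos,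
      abs_of_pos Real.two_pi_pos]
    simp
  have hlow : 4 * δ ≤ ‖(ZMod.stdAddChar (-k) : ℂ) ^ (2 * t) - 1‖ := by
    rw [stdAddChar_neg_eq_exp, Complex.norm_exp_I_mul_ofReal_sub_one, norm_mul, Real.norm_eq_abs,
      Real.norm_eq_abs, abs_two]
    have hs : |Real.sin (-(2 * Real.pi * k.valMinAbs * (2 * t : ℕ) / M) / 2)|
        = |Real.sin (Real.pi * (q * t / H))| := by
      have e : -(2 * Real.pi * k.valMinAbs * (2 * t : ℕ) / M) / 2
          = -(Real.pi * (k.valMinAbs * t / H)) := by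
        rw [hH]; push_cast; field_simp
      rw [e, Real.sin_neg, abs_neg, ← hqa]
      rcases abs_cases (k.valMinAbs : ℝ) with ⟨h, _⟩ | ⟨h, _⟩ <;> rw [h]
      rw [neg_mul, neg_div, mul_neg, Real.sin_neg, abs_neg]
    rw [hs]
    have := two_mul_abs_sub_round_le_abs_sin (q * t / H)
    linarith
  have h := hlow.trans_eq hnorm.symm
  have h2 := h.trans (mul_le_mul_of_nonneg_left hup (norm_nonneg _))
  have hpi := Real.pi_pos
  rw [div_le_iff₀ hqpos, div_mul_eq_mul_div, div_le_iff₀ hpi]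
  rw [mul_div_assoc', le_div_iff₀ hMpos] at h2
  linarith

/-- On average over `t`, the product of Fourier coefficients of arcs is as large as the trivial
bound allows. -/
lemma le_sum_prod_arcCoeff {ι : Type*} [Fintype ι] {H N : ℕ} (hM : M = 2 * H)
    (hι : 0 < Fintype.card ι) (hN : 0 < N) (hMN : 18 * Fintype.card ι * N ≤ M) {k : ι → ZMod M}
    (hk : ∀ i, (k i).valMinAbs.natAbs < 4 * N) :
    ((H - 1 : ℕ) : ℝ) / 4 * ∏ i, ((1 / (18 * Real.pi * Fintype.card ι) * M) ^ 2
        * (1 / (max 1 (k i).valMinAbs.natAbs : ℝ) ^ 2))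
      ≤ ∑ t ∈ Icc 1 (H - 1), ∏ i, ‖arcCoeff t (k i)‖ ^ 2 := by
  classical
  set d := Fintype.card ι with hd
  have hdN : 9 * (d * N) ≤ H := by linarith
  have hdN1 : 1 ≤ d * N := Nat.mul_pos hι hN
  have hH9 : 9 ≤ H := by omega
  have hd1 : (1 : ℝ) ≤ d := by exact_mod_cast hι
  have hHr : (0 : ℝ) < H := by exact_mod_cast (by omega : 0 < H)
  have hMr : (M : ℝ) = 2 * H := by rw [hM]; push_cast; ring
  set δ : ℝ := 1 / (36 * d) with hδ
  have hδ0 : 0 < δ := by positivity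
  set bad : ι → Finset ℕ := fun i => if k i = 0 then ∅ else
    {t ∈ range H | |((k i).valMinAbs.natAbs * t / H : ℝ)
      - round ((k i).valMinAbs.natAbs * t / H : ℝ)| < δ} with hbad
  set small : Finset ℕ := Icc 1 (H / 9) with hsmall
  set good : Finset ℕ := Icc 1 (H - 1) \ (small ∪ univ.biUnion bad) with hgood
  have hbadcard : ∀ i, (#(bad i) : ℝ) ≤ H / (9 * d) + 4 * N := by
    intro i
    simp only [hbad]
    split_ifs with h0
    · simp; positivity
    · have hq : 0 < (k i).valMinAbs.natAbs :=
        Int.natAbs_pos.2 ((ZMod.valMinAbs_eq_zero _).not.2 h0)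
      refine (card_filter_abs_sub_round_lt_le (by omega) hq hδ0).trans ?_
      have h4 : ((k i).valMinAbs.natAbs : ℝ) + 1 ≤ 4 * N := by exact_mod_cast hk i
      have : 4 * δ * H = H / (9 * d) := by rw [hδ]; field_simp; norm_num
      linarith
  have hgoodcard : ((H - 1 : ℕ) : ℝ) / 4 ≤ #good := by
    have h1 : #(Icc 1 (H - 1)) ≤ #good + (#small + #(univ.biUnion bad)) := by
      have := le_card_sdiff (small ∪ univ.biUnion bad) (Icc 1 (H - 1))
      rw [← hgood] at this
      have := card_union_le small (univ.biUnion bad)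
      omega
    have h2 : (#(univ.biUnion bad) : ℝ) ≤ ∑ i, (#(bad i) : ℝ) := by
      exact_mod_cast card_biUnion_le
    have h3 : ∑ i, (#(bad i) : ℝ) ≤ d * (H / (9 * d) + 4 * N) := by
      refine (sum_le_sum fun i _ => hbadcard i).trans_eq ?_
      rw [sum_const, card_univ, nsmul_eq_mul]
    have h4 : (d : ℝ) * (H / (9 * d) + 4 * N) = H / 9 + 4 * (d * N) := by field_simp
    have h5 : (#small : ℝ) ≤ H / 9 := by
      rw [hsmall, Nat.card_Icc]
      exact_mod_cast Nat.cast_div_le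
    have h6 : (9 : ℝ) * (d * N) ≤ H := by exact_mod_cast hdN
    have h7 : ((H - 1 : ℕ) : ℝ) = H - 1 := by rw [Nat.cast_sub (by omega)]; simp
    have h8 : ((H - 1 : ℕ) : ℝ) ≤ #good + (#small + #(univ.biUnion bad)) := by
      rw [Nat.card_Icc] at h1
      exact_mod_cast (by omega : H - 1 ≤ _)
    have h9 : (9 : ℝ) ≤ H := by exact_mod_cast hH9
    linarith
  have hterm : ∀ t ∈ good, ∏ i, ((1 / (18 * Real.pi * d) * M) ^ 2
        * (1 / (max 1 (k i).valMinAbs.natAbs : ℝ) ^ 2)) ≤ ∏ i, ‖arcCoeff t (k i)‖ ^ 2 := by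
    intro t ht
    simp only [hgood, mem_sdiff, mem_union, mem_biUnion, mem_univ, true_and, not_or, not_exists,
      mem_Icc, hsmall] at ht
    obtain ⟨⟨ht1, htH⟩, hts, htb⟩ := ht
    refine prod_le_prod (fun i _ => by positivity) fun i _ => ?_
    rw [← one_div_pow, ← mul_pow]
    refine pow_le_pow_left₀ (by positivity) ?_ 2
    by_cases h0 : k i = 0
    · rw [h0, norm_arcCoeff_zero (by omega)]
      have h9 : (H : ℝ) ≤ 9 * t := by exact_mod_cast (by omega : H ≤ 9 * t)
      have hc : 1 / (18 * Real.pi * d) ≤ 1 / 18 := by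
        refine one_div_le_one_div_of_le (by norm_num) ?_
        nlinarith [Real.pi_gt_three]
      have : 1 / (18 * Real.pi * d) * M ≤ 1 / 18 * M := by gcongr
      simp only [ZMod.valMinAbs_zero, Int.natAbs_zero, Nat.cast_zero]
      norm_num at this ⊢
      linarith
    · have hq : 0 < (k i).valMinAbs.natAbs :=
        Int.natAbs_pos.2 ((ZMod.valMinAbs_eq_zero _).not.2 h0)
      have hb := htb i
      simp only [hbad, if_neg h0, mem_filter, mem_range, not_and, not_lt] at hb
      refine le_trans (le_of_eq ?_) (le_norm_arcCoeff hM (by omega) h0 (hb (by omega)))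
      rw [max_eq_right (by exact_mod_cast hq), hδ]
      have := Real.pi_pos
      field_simp
      ring
  calc _ ≤ (#good : ℝ) * ∏ i, ((1 / (18 * Real.pi * d) * M) ^ 2
        * (1 / (max 1 (k i).valMinAbs.natAbs : ℝ) ^ 2)) :=
        mul_le_mul_of_nonneg_right hgoodcard (prod_nonneg fun i _ => by positivity)
    _ = ∑ _t ∈ good, _ := by rw [sum_const, nsmul_eq_mul]
    _ ≤ _ := sum_le_sum hterm
    _ ≤ _ := sum_le_sum_of_subset_of_nonneg sdiff_subset
        fun _ _ _ => prod_nonneg fun i _ => by positivity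

end Arc

section Discrepancy

variable {ι ν : Type*} [Fintype ι] [DecidableEq ι] [Fintype ν] {M : ℕ} [NeZero M]

/-- The discrepancy of the points `a n` in `(ℤ/M)^ι` with respect to the cube of half-side `t`
centered at `g`, normalized by a constant `c`. -/
def cubeDiscrepancy (a : ν → ι → ZMod M) (t : ℕ) (c : ℝ) (g : ι → ZMod M) : ℝ :=
  ∑ n, ∏ i, arc t (a n i - g i) - c

lemma sum_arc_sub_mul_stdAddChar (t : ℕ) (k b : ZMod M) :
    ∑ x, (arc t (b - x) : ℂ) * ZMod.stdAddChar (k * x)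
      = ZMod.stdAddChar (k * b) * arcCoeff t k := by
  rw [arcCoeff, ← (Equiv.subLeft b).sum_comp, mul_sum]
  refine sum_congr rfl fun u _ => ?_
  rw [Equiv.subLeft_apply, sub_sub_cancel, mul_left_comm, ← AddChar.map_add_eq_mul]
  ring_nf

lemma transform_cubeDiscrepancy (a : ν → ι → ZMod M) (t : ℕ) (c : ℝ) {k : ι → ZMod M}
    (hk : k ≠ 0) :
    ∑ g, (cubeDiscrepancy a t c g : ℂ) * torusChar k g = expSum a k * ∏ i, arcCoeff t (k i) := by
  have hconst : ∑ g, (c : ℂ) * torusChar k g = 0 := by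
    simp_rw [← mul_sum, torusChar_comm k, sum_torusChar, if_neg hk, mul_zero]
  simp only [cubeDiscrepancy, Complex.ofReal_sub, sub_mul, sum_sub_distrib, hconst, sub_zero]
  push_cast
  simp_rw [sum_mul]
  rw [sum_comm, expSum, sum_mul]
  refine sum_congr rfl fun n _ => ?_
  simp_rw [torusChar, ← prod_mul_distrib, ← sum_arc_sub_mul_stdAddChar]
  rw [prod_univ_sum, Fintype.piFinset_univ]

lemma sum_expSum_mul_arcCoeff_le (a : ν → ι → ZMod M) (t : ℕ) (c : ℝ) (K : Finset (ι → ZMod M))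
    (hK : 0 ∉ K) :
    ∑ k ∈ K, ‖expSum a k‖ ^ 2 * ∏ i, ‖arcCoeff t (k i)‖ ^ 2
      ≤ (M : ℝ) ^ Fintype.card ι * ∑ g, cubeDiscrepancy a t c g ^ 2 := by
  rw [← sum_norm_sq_transform]
  refine le_trans (le_of_eq (sum_congr rfl fun k hk => ?_))
    (sum_le_sum_of_subset_of_nonneg (subset_univ K) fun _ _ _ => by positivity)
  rw [transform_cubeDiscrepancy a t c (ne_of_mem_of_not_mem hk hK), norm_mul, norm_prod, mul_pow,
    prod_pow]

/-- The mean square cube discrepancy of `N` points on the grid `(ℤ/M)^ι`. -/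
lemma le_sum_cubeDiscrepancy {H R : ℕ} (hM : M = 2 * H) (hι : 0 < Fintype.card ι)
    (hν : 0 < Fintype.card ν) (hMN : 18 * Fintype.card ι * Fintype.card ν ≤ M)
    (hR : 2 * Fintype.card ν ≤ 2 ^ R) (hR' : 2 ^ R < 4 * Fintype.card ν)
    (a : ν → ι → ZMod M) (c : ℕ → ℝ) :
    (1 / (18 * Real.pi * Fintype.card ι)) ^ (2 * Fintype.card ι) * (3 / 4) ^ Fintype.card ι / 64
        * #(piAntidiag (univ : Finset ι) R) * ((M : ℝ) ^ Fintype.card ι * (H - 1 : ℕ))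
      ≤ ∑ g, ∑ t ∈ Icc 1 (H - 1), cubeDiscrepancy a t (c t) g ^ 2 := by
  set d := Fintype.card ι with hd
  set N := Fintype.card ν with hN
  have hMr : (0 : ℝ) < M := by exact_mod_cast NeZero.pos M
  have hNr : (0 : ℝ) < N := by exact_mod_cast hν
  have hRM : 2 ^ R ≤ M := by nlinarith
  set γ : ℝ := 1 / (18 * Real.pi * d) with hγ
  set K : Finset (ι → ZMod M) := {k : ι → ZMod M | k ≠ 0 ∧ ∀ i, (k i).valMinAbs.natAbs < 2 ^ R}
    with hK
  have hbox := card_piAntidiag_le_sum_expSum a hRM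
  rw [← hK, ← hN] at hbox
  have hvol : 1 / 16 ≤ (1 / 4 : ℝ) ^ R * (N * (2 ^ R - N)) := by
    have h1 : (2 * N : ℝ) ≤ 2 ^ R := by exact_mod_cast hR
    have h2 : (2 : ℝ) ^ R ≤ 4 * N := by exact_mod_cast hR'.le
    have h4 : (4 : ℝ) ^ R = 2 ^ R * 2 ^ R := by rw [← mul_pow]; norm_num
    rw [one_div_pow, one_div_mul_eq_div, div_le_div_iff₀ (by norm_num) (by positivity), h4]
    nlinarith
  have hparseval : ∑ k ∈ K, ‖expSum a k‖ ^ 2 * ∑ t ∈ Icc 1 (H - 1), ∏ i, ‖arcCoeff t (k i)‖ ^ 2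
      ≤ (M : ℝ) ^ d * ∑ g, ∑ t ∈ Icc 1 (H - 1), cubeDiscrepancy a t (c t) g ^ 2 := by
    have hswap : ∑ k ∈ K, ‖expSum a k‖ ^ 2 * ∑ t ∈ Icc 1 (H - 1), ∏ i, ‖arcCoeff t (k i)‖ ^ 2
        = ∑ t ∈ Icc 1 (H - 1), ∑ k ∈ K, ‖expSum a k‖ ^ 2 * ∏ i, ‖arcCoeff t (k i)‖ ^ 2 := by
      simp_rw [mul_sum]
      exact sum_comm
    rw [hswap, sum_comm (s := (univ : Finset (ι → ZMod M))), mul_sum]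
    exact sum_le_sum fun t _ => sum_expSum_mul_arcCoeff_le a t (c t) K (by simp [hK])
  have hcoeff : (((H - 1 : ℕ) : ℝ) / 4 * ((γ * M) ^ 2 * (3 / 4)) ^ d) *
      ∑ k ∈ K, ‖expSum a k‖ ^ 2 * ∏ i, (4 / 3 * (1 / (max 1 (k i).valMinAbs.natAbs : ℝ) ^ 2))
      ≤ ∑ k ∈ K, ‖expSum a k‖ ^ 2 * ∑ t ∈ Icc 1 (H - 1), ∏ i, ‖arcCoeff t (k i)‖ ^ 2 := by
    rw [mul_sum]
    refine sum_le_sum fun k hk => ?_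
    simp only [hK, mem_filter, mem_univ, true_and] at hk
    refine le_trans (le_of_eq ?_) (mul_le_mul_of_nonneg_left
      (le_sum_prod_arcCoeff hM hι hν hMN fun i => (hk.2 i).trans hR') (by positivity))
    simp only [prod_mul_distrib, prod_const, card_univ, ← hd, ← hγ, mul_pow]
    have h43 : (3 / 4 : ℝ) ^ d * (4 / 3) ^ d = 1 := by rw [← mul_pow]; norm_num
    linear_combination ((H - 1 : ℕ) : ℝ) / 4 * ((γ ^ 2) ^ d * (M ^ 2) ^ d) * ‖expSum a k‖ ^ 2
      * (∏ i, 1 / (max 1 (k i).valMinAbs.natAbs : ℝ) ^ 2) * h43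
  have hcard : (#(piAntidiag (univ : Finset ι) R) : ℝ) * (1 / 16)
      ≤ ∑ k ∈ K, ‖expSum a k‖ ^ 2
        * ∏ i, (4 / 3 * (1 / (max 1 (k i).valMinAbs.natAbs : ℝ) ^ 2)) :=
    (mul_le_mul_of_nonneg_left hvol (by positivity)).trans hbox
  have htotal := (mul_le_mul_of_nonneg_left hcard
    (by positivity : 0 ≤ ((H - 1 : ℕ) : ℝ) / 4 * ((γ * M) ^ 2 * (3 / 4)) ^ d)).trans
      (hcoeff.trans hparseval)
  refine le_of_mul_le_mul_left (a := (M : ℝ) ^ d) (le_trans (le_of_eq ?_) htotal) (by positivity)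
  ring_nf

end Discrepancy

lemma fract_lt_iff_val_lt {M : ℕ} [NeZero M] (y : ℝ) (j : ℤ) (t : ℕ) :
    Int.fract (y - (j : ℝ) / M + t / M) < 2 * ((t : ℝ) / M)
      ↔ (((⌊M * y⌋ : ℤ) : ZMod M) - (j : ZMod M) + t).val < 2 * t := by
  have hM : (0 : ℝ) < M := by exact_mod_cast NeZero.pos M
  set z := y - (j : ℝ) / M + t / M with hz
  have hfloor : ⌊M * Int.fract z⌋ = (⌊M * y⌋ - j + t) % (M : ℤ) := by
    have h1 : M * Int.fract z = M * y + ((-j + t - M * ⌊z⌋ : ℤ) : ℝ) := by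
      rw [Int.fract, hz]
      push_cast
      field_simp
      ring
    have h2 : ⌊M * Int.fract z⌋ = ⌊M * y⌋ - j + t - M * ⌊z⌋ := by
      rw [h1, Int.floor_add_intCast]
      ring
    have h3 : 0 ≤ ⌊M * Int.fract z⌋ := Int.floor_nonneg.2 (by positivity)
    have h4 : ⌊M * Int.fract z⌋ < M := by
      rw [Int.floor_lt]
      push_cast
      nlinarith [Int.fract_lt_one z]
    rw [← Int.emod_eq_of_lt h3 h4, h2]
    simp
  have hval : ((((⌊M * y⌋ : ℤ) : ZMod M) - (j : ZMod M) + t).val : ℤ) = ⌊M * Int.fract z⌋ := by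
    rw [hfloor, ← ZMod.val_intCast]
    push_cast
    rfl
  have h5 : Int.fract z < 2 * ((t : ℝ) / M) ↔ M * Int.fract z < ((2 * t : ℤ) : ℝ) := by
    rw [mul_div_assoc', lt_div_iff₀ hM, mul_comm]
    push_cast
    rfl
  rw [h5, ← Int.floor_lt, ← hval]
  norm_cast

lemma sum_piFinset_Ico_intCast {ι : Type*} [Fintype ι] [DecidableEq ι] {M H : ℕ} [NeZero M]
    (hM : M = 2 * H) (f : (ι → ZMod M) → ℝ) :
    ∑ j ∈ Fintype.piFinset fun _ : ι => Ico (-(M : ℤ) / 2) ((M : ℤ) / 2),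
      f (fun i => (j i : ZMod M)) = ∑ g, f g := by
  have hlo : -(M : ℤ) / 2 = -H := by omega
  have hhi : (M : ℤ) / 2 = H := by omega
  rw [hlo, hhi]
  refine sum_bij (fun j _ i => (j i : ZMod M)) (fun _ _ => mem_univ _) ?_ ?_ fun _ _ => rfl
  · intro j hj l hl h
    funext i
    have hji := mem_Ico.1 (Fintype.mem_piFinset.1 hj i)
    have hli := mem_Ico.1 (Fintype.mem_piFinset.1 hl i)
    have hd := (ZMod.intCast_eq_intCast_iff_dvd_sub _ _ _).1 (congrFun h i)
    have := Int.eq_zero_of_abs_lt_dvd hd (by rw [abs_lt]; omega)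
    omega
  · intro g _
    refine ⟨fun i => if (g i).valMinAbs = H then -H else (g i).valMinAbs,
      Fintype.mem_piFinset.2 fun i => ?_, funext fun i => ?_⟩
    · have := Set.mem_Ioc.1 (ZMod.valMinAbs_mem_Ioc (g i))
      rw [mem_Ico]
      split_ifs <;> omega
    · dsimp only
      split_ifs with h
      · have h2 : ((H : ℤ) : ZMod M) = ((-H : ℤ) : ZMod M) := by
          rw [ZMod.intCast_eq_intCast_iff_dvd_sub]
          exact ⟨-1, by rw [hM]; push_cast; ring⟩
        rw [← h2, ← h, ZMod.coe_valMinAbs]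
      · exact ZMod.coe_valMinAbs _

lemma exists_two_pow_mem_Ico {N : ℕ} (hN : 0 < N) : ∃ R, 2 * N ≤ 2 ^ R ∧ 2 ^ R < 4 * N := by
  refine ⟨Nat.clog 2 (2 * N), Nat.le_pow_clog (by norm_num) _, ?_⟩
  have h := Nat.pow_pred_clog_lt_self (b := 2) (by norm_num) (x := 2 * N) (by omega)
  have hpos := Nat.clog_pos (b := 2) (n := 2 * N) (by norm_num) (by omega)
  obtain ⟨m, hm⟩ := Nat.exists_eq_succ_of_ne_zero hpos.ne'
  rw [hm] at h ⊢
  rw [Nat.pow_succ]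
  simp at h
  omega

lemma log_le_of_le_two_pow {N R : ℕ} (hN : 0 < N) (hR : 2 * N ≤ 2 ^ R) : Real.log N ≤ R := by
  have h : (N : ℝ) ≤ Real.exp R := by
    calc (N : ℝ) ≤ 2 ^ R := by exact_mod_cast (by omega : N ≤ 2 ^ R)
      _ ≤ Real.exp 1 ^ R := by gcongr; linarith [Real.exp_one_gt_d9]
      _ = Real.exp R := by rw [← Real.exp_nat_mul, mul_one]
  rwa [Real.log_le_iff_le_exp (by exact_mod_cast hN)]

end CubeDiscrepancy

open CubeDiscrepancy

/-- Discrete version of Halász's theorem for periodized cubes on the torus: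
for every even `M ≥ 18dN`, the discrete `ℓ²` average over centers
`(j₁/M,…,j_d/M)`, `j ∈ J_M^d`, and half-sides `s = t/M ∈ S_M` of the discrepancy
with respect to the cubes `x + Q(s)` is at least `c·(log N)^((d-1)/2)`.
Membership of a point `y` in the periodized cube `x + [-s,s)^d + ℤ^d` is expressed
as `Int.fract (yᵢ - xᵢ + s) < 2s` for every `i`. -/
theorem stmt15 (d : ℕ) (hd : 0 < d) :
    ∃ c : ℝ, 0 < c ∧
      ∀ (N M : ℕ), 0 < N → Even M → 18 * d * N ≤ M →
        ∀ p : Fin N → Fin d → ℝ,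
          c * Real.log N ^ (((d : ℝ) - 1) / 2) ≤
            Real.sqrt ((1 / (M : ℝ) ^ d) * (1 / ((M / 2 - 1 : ℕ) : ℝ)) *
              ∑ j ∈ Fintype.piFinset fun _ : Fin d => Finset.Ico (-(M : ℤ) / 2) ((M : ℤ) / 2),
                ∑ t ∈ Finset.Icc 1 (M / 2 - 1),
                  ((∑ n, Set.indicator
                      {y : Fin d → ℝ |
                        ∀ i, Int.fract (y i - (j i : ℝ) / M + t / M) < 2 * ((t : ℝ) / M)}
                      (fun _ => (1 : ℝ)) (p n))
                    - N * (2 * ((t : ℝ) / M)) ^ d) ^ 2) := by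
  set C : ℝ := (1 / (18 * Real.pi * d)) ^ (2 * d) * (3 / 4) ^ d / 64 / (d - 1).factorial with hC
  have hCpos : 0 < C := by
    have := Real.pi_pos
    positivity
  refine ⟨√C, Real.sqrt_pos.2 hCpos, ?_⟩
  rintro N M hN ⟨H, hM⟩ hMN p
  replace hM : M = 2 * H := by omega
  have hdN : 1 ≤ d * N := Nat.mul_pos hd hN
  have hMN' : 9 * (d * N) ≤ H := by linarith
  have hMpos : 0 < M := by omega
  have : NeZero M := ⟨hMpos.ne'⟩
  obtain ⟨R, hR, hR'⟩ := exists_two_pow_mem_Ico hN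
  have hMH : M / 2 = H := by omega
  have hsum := le_sum_cubeDiscrepancy (ι := Fin d) (ν := Fin N) hM (by simpa using hd)
    (by simpa using hN) (by simpa using hMN) (by simpa using hR) (by simpa using hR')
    (fun n i => ((⌊M * p n i⌋ : ℤ) : ZMod M)) fun t => N * (2 * ((t : ℝ) / M)) ^ d
  have hcount := pow_div_factorial_le_card_piAntidiag (ι := Fin d) (by simpa using hd) R
  simp only [Fintype.card_fin] at hsum hcount
  rw [← sum_piFinset_Ico_intCast hM] at hsum
  have hind : ∀ (j : Fin d → ℤ) (t : ℕ),
      (∑ n, Set.indicator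
          {y : Fin d → ℝ | ∀ i, Int.fract (y i - (j i : ℝ) / M + t / M) < 2 * ((t : ℝ) / M)}
          (fun _ => (1 : ℝ)) (p n)) - N * (2 * ((t : ℝ) / M)) ^ d
        = cubeDiscrepancy (fun n i => ((⌊M * p n i⌋ : ℤ) : ZMod M)) t
            (N * (2 * ((t : ℝ) / M)) ^ d) (fun i => (j i : ZMod M)) := by
    intro j t
    rw [cubeDiscrepancy]
    congr 1
    refine Finset.sum_congr rfl fun n _ => ?_
    simp only [Set.indicator_apply, Set.mem_ofPred_eq, fract_lt_iff_val_lt, arc]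
    rw [Finset.prod_ite_zero]
    simp
  simp_rw [hind, hMH]
  have hH1 : (0 : ℝ) < ((H - 1 : ℕ) : ℝ) := by exact_mod_cast (by omega : 0 < H - 1)
  have hMr : (0 : ℝ) < M := by exact_mod_cast hMpos
  have hlog0 : 0 ≤ Real.log N := Real.log_natCast_nonneg N
  have hpow : Real.log N ^ (((d : ℝ) - 1) / 2) = √(Real.log N ^ (d - 1)) := by
    rw [Real.sqrt_eq_rpow, ← Real.rpow_natCast, ← Real.rpow_mul hlog0, Nat.cast_sub hd]
    congr 1
    push_cast
    ring
  rw [hpow, ← Real.sqrt_mul hCpos.le]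
  refine Real.sqrt_le_sqrt ?_
  have hmain : C * Real.log N ^ (d - 1) ≤ (1 / (18 * Real.pi * d)) ^ (2 * d) * (3 / 4) ^ d / 64
      * (Finset.piAntidiag (Finset.univ : Finset (Fin d)) R).card := by
    rw [hC, div_mul_eq_mul_div, mul_div_assoc]
    have := Real.pi_pos
    refine mul_le_mul_of_nonneg_left (le_trans ?_ hcount) (by positivity)
    gcongr
    exact log_le_of_le_two_pow hN hR
  refine hmain.trans (le_trans (le_of_eq ?_) (mul_le_mul_of_nonneg_left hsum (by positivity)))
  field_simp
end
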